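/- Let P be an abstract simplicial complex on a finite vertex set V whose geometric realization ‖P‖ is homeomorphic to the sphere S^{d−1}, and let K be a field. Then for every subset I ⊆ V and every integer i ≥ 1 there is an isomorphism of K-vector spaces H̃_{d−1−i}(P_{≤Î}; K) ≅ H̃^{i−1}(P_{≤I}; K), where Î = V∖I; in particular, dim_K H̃_{d−1−i}(P_{≤Î}; K) = dim_K H̃_{i−1}(P_{≤I}; K). -/

import Mathlib

open Finset

/-- An abstract simplicial complex on a vertex type `V`: a collection of finite subsets of `V`
(called faces) closed under taking subsets. -/
structure ASC (V : Type) where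
  faces : Set (Finset V)
  down_closed : ∀ ⦃σ τ : Finset V⦄, σ ∈ faces → τ ⊆ σ → τ ∈ faces

namespace ASC

variable {V : Type}

/-- `Γ.restrict σ` is the subcomplex `Γ_{≤σ}` of all faces of `Γ` contained in `σ`. -/
def restrict (Γ : ASC V) (σ : Finset V) : ASC V where
  faces := {τ | τ ∈ Γ.faces ∧ τ ⊆ σ}
  down_closed := by
    intro τ τ' h hsub
    exact ⟨Γ.down_closed h.1 hsub, hsub.trans h.2⟩

/-- The link of `σ` in `Γ`: all faces `τ` with `τ ∪ σ ∈ Γ` and `τ ∩ σ = ∅`. -/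
def link [DecidableEq V] (Γ : ASC V) (σ : Finset V) : ASC V where
  faces := {τ | τ ∪ σ ∈ Γ.faces ∧ τ ∩ σ = ∅}
  down_closed := by
    intro τ τ' h hsub
    refine ⟨Γ.down_closed h.1 (Finset.union_subset_union hsub (Finset.Subset.refl σ)), ?_⟩
    rw [← Finset.subset_empty, ← h.2]
    exact Finset.inter_subset_inter hsub (Finset.Subset.refl σ)

/-- The Alexander dual `Γ* = {σ ⊆ V ∣ V∖σ ∉ Γ}`. -/
def dual [DecidableEq V] [Fintype V] (Γ : ASC V) : ASC V where
  faces := {σ | σᶜ ∉ Γ.faces}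
  down_closed := by
    intro σ τ hσ hsub hmem
    exact hσ (Γ.down_closed hmem (Finset.compl_subset_compl.mpr hsub))

/-- A maximal face (facet) of `Γ`. -/
def IsMaximalFace (Γ : ASC V) (τ : Finset V) : Prop :=
  τ ∈ Γ.faces ∧ ∀ τ' ∈ Γ.faces, τ ⊆ τ' → τ' = τ

/-- A minimal non-face of `Γ`: not a face of `Γ`, but all of its proper subsets are faces. -/
def IsMinimalNonFace (Γ : ASC V) (J : Finset V) : Prop :=
  J ∉ Γ.faces ∧ ∀ J' ⊂ J, J' ∈ Γ.faces

/-- `I` belongs to `U_SR`: it is a union of (a nonempty finite family of)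
minimal non-faces of `Γ`. -/
def memUSR [DecidableEq V] (Γ : ASC V) (I : Finset V) : Prop :=
  ∃ S : Finset (Finset V), S.Nonempty ∧ (∀ J ∈ S, Γ.IsMinimalNonFace J) ∧ I = S.sup id

section Homology

variable (K : Type) [Field K] [LinearOrder V]

/-- The `j`-dimensional faces of `Γ` (faces of cardinality `j + 1`). -/
def Cells (Γ : ASC V) (j : ℤ) : Type :=
  {σ : Finset V // σ ∈ Γ.faces ∧ (σ.card : ℤ) = j + 1}

/-- The space of simplicial `j`-chains with coefficients in `K`, i.e. the free `K`-module on the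
`j`-dimensional faces.  (This is the augmented/reduced chain complex: the empty face, if present,
spans the chains in degree `-1`.) -/
def Chains (Γ : ASC V) (j : ℤ) : Type := Cells Γ j →₀ K

noncomputable instance (Γ : ASC V) (j : ℤ) : AddCommGroup (Chains K Γ j) :=
  inferInstanceAs (AddCommGroup (Cells Γ j →₀ K))

noncomputable instance (Γ : ASC V) (j : ℤ) : Module K (Chains K Γ j) :=
  inferInstanceAs (Module K (Cells Γ j →₀ K))

/-- The simplicial boundary map from `j`-chains to `k = (j-1)`-chains, with the usual
alternating signs determined by the linear order on the vertices. -/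
noncomputable def boundary (Γ : ASC V) (j k : ℤ) (hk : k = j - 1) :
    Chains K Γ j →ₗ[K] Chains K Γ k :=
  Finsupp.lsum K fun σ : Cells Γ j =>
    LinearMap.toSpanSingleton K (Chains K Γ k)
      (∑ v ∈ σ.1.attach,
        (Finsupp.single
          (⟨σ.1.erase v.1,
            Γ.down_closed σ.2.1 (Finset.erase_subset _ _), by
              have h1 := Finset.card_erase_of_mem v.2
              have h2 : 1 ≤ σ.1.card := Finset.card_pos.mpr ⟨v.1, v.2⟩
              have h3 := σ.2.2
              omega⟩ : Cells Γ k)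
          ((-1 : K) ^ (σ.1.filter (fun w => w < v.1)).card) : Cells Γ k →₀ K))

/-- Reduced simplicial homology of `Γ` in degree `j` with coefficients in `K`:
cycles modulo (cycles that are boundaries). -/
noncomputable abbrev reducedHomology (Γ : ASC V) (j : ℤ) : Type :=
  ↥(LinearMap.ker (boundary K Γ j (j - 1) rfl)) ⧸
    Submodule.comap (LinearMap.ker (boundary K Γ j (j - 1) rfl)).subtype
      (LinearMap.range (boundary K Γ (j + 1) j (by omega)))

/-- Simplicial `j`-cochains: the `K`-linear dual of the space of `j`-chains. -/
def Cochains (Γ : ASC V) (j : ℤ) : Type := Chains K Γ j →ₗ[K] K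

noncomputable instance (Γ : ASC V) (j : ℤ) : AddCommGroup (Cochains K Γ j) :=
  inferInstanceAs (AddCommGroup (Chains K Γ j →ₗ[K] K))

noncomputable instance (Γ : ASC V) (j : ℤ) : Module K (Cochains K Γ j) :=
  inferInstanceAs (Module K (Chains K Γ j →ₗ[K] K))

/-- The simplicial coboundary map, the dual of the boundary map. -/
noncomputable def coboundary (Γ : ASC V) (j k : ℤ) (hk : k = j + 1) :
    Cochains K Γ j →ₗ[K] Cochains K Γ k :=
  (boundary K Γ k j (by omega)).dualMap

/-- Reduced simplicial cohomology of `Γ` in degree `j` with coefficients in `K`: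
cocycles modulo (cocycles that are coboundaries). -/
noncomputable abbrev reducedCohomology (Γ : ASC V) (j : ℤ) : Type :=
  ↥(LinearMap.ker (coboundary K Γ j (j + 1) rfl)) ⧸
    Submodule.comap (LinearMap.ker (coboundary K Γ j (j + 1) rfl)).subtype
      (LinearMap.range (coboundary K Γ (j - 1) j (by omega)))

end Homology

/-- The geometric realization `‖Γ‖` of `Γ`, as the subset of `V → ℝ` consisting of the
convex-weight functions whose support is a face of `Γ`. -/
def realization [Fintype V] (Γ : ASC V) : Set (V → ℝ) :=
  {x | (∀ v, 0 ≤ x v) ∧ (∑ v, x v) = 1 ∧ ∃ τ ∈ Γ.faces, ∀ v, x v ≠ 0 ↔ v ∈ τ}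

end ASC

section FreeModules

variable {K : Type*} [Field K] {ι M : Type*} [AddCommGroup M] [Module K M]

lemma map_mem_of_mem_supported {T : Set ι} {f : (ι →₀ K) →ₗ[K] M} {N : Submodule K M}
    (h : ∀ i ∈ T, f (Finsupp.single i 1) ∈ N) {c : ι →₀ K}
    (hc : c ∈ Finsupp.supported K K T) : f c ∈ N := by
  rw [Finsupp.supported_eq_span_single] at hc
  induction hc using Submodule.span_induction with
  | mem x hx => obtain ⟨i, hi, rfl⟩ := hx; exact h i hi
  | zero => simp
  | add x y _ _ hx hy => rw [map_add]; exact N.add_mem hx hy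
  | smul a x _ hx => rw [map_smul]; exact N.smul_mem a hx

lemma map_eq_of_mem_supported {T : Set ι} {f g : (ι →₀ K) →ₗ[K] M}
    (h : ∀ i ∈ T, f (Finsupp.single i 1) = g (Finsupp.single i 1)) {c : ι →₀ K}
    (hc : c ∈ Finsupp.supported K K T) : f c = g c := by
  have := map_mem_of_mem_supported (f := f - g) (N := ⊥)
    (fun i hi => by simp [h i hi]) hc
  simpa [sub_eq_zero] using this

/-- A primitive of a homogeneous chain can be chosen homogeneous. -/
lemma exists_homogeneous_primitive (deg : ι → ℕ) (D : (ι →₀ K) →ₗ[K] (ι →₀ K))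
    (hD : ∀ i, D (Finsupp.single i 1) ∈ Finsupp.supported K K {k | deg k + 1 = deg i})
    {T : Set ι} {n : ℕ} {z w : ι →₀ K} (hz : z ∈ Finsupp.supported K K {i | deg i = n})
    (hw : w ∈ Finsupp.supported K K T) (h : D w = z) :
    ∃ w' ∈ Finsupp.supported K K (T ∩ {i | deg i = n + 1}), D w' = z := by
  classical
  let pr : ℕ → (ι →₀ K) →ₗ[K] (ι →₀ K) := fun m =>
    Finsupp.linearCombination K (fun i => if deg i = m then Finsupp.single i (1 : K) else 0)
  have pr_single : ∀ m i, pr m (Finsupp.single i 1) = if deg i = m then Finsupp.single i 1 else 0 :=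
    fun m i => by simp [pr]
  have hcomm : ∀ c, D (pr (n + 1) c) = pr n (D c) := by
    intro c
    refine map_eq_of_mem_supported (T := Set.univ) (f := D ∘ₗ pr (n + 1)) (g := pr n ∘ₗ D) ?_
      (by simp)
    intro i _
    simp only [LinearMap.comp_apply, pr_single]
    split_ifs with hi
    · refine (map_eq_of_mem_supported (f := pr n) (g := LinearMap.id) ?_ (hD i)).symm
      intro k hk
      have : deg k = n := by simp only [Set.mem_ofPred_eq] at hk; omega
      simp [pr_single, this]
    · rw [map_zero]
      refine (map_eq_of_mem_supported (f := pr n) (g := 0) ?_ (hD i)).symm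
      intro k hk
      have : deg k ≠ n := by simp only [Set.mem_ofPred_eq] at hk; omega
      simp [pr_single, this]
  refine ⟨pr (n + 1) w, map_mem_of_mem_supported ?_ hw, ?_⟩
  · intro i hi
    rw [pr_single]
    split_ifs with h'
    · exact Finsupp.single_mem_supported K 1 ⟨hi, h'⟩
    · exact Submodule.zero_mem _
  · rw [hcomm, h]
    refine map_eq_of_mem_supported (f := pr n) (g := LinearMap.id) ?_ hz
    intro k hk
    simp only [Set.mem_ofPred_eq] at hk
    simp [pr_single, hk]

end FreeModules

/-! ### Augmented ordered chains on a set of points -/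

namespace ListChain

variable (K : Type*) [Field K] {X Y : Type*}

/-- Prepending the point `x` to all the tuples of an ordered chain. -/
noncomputable def cone (x : X) : (List X →₀ K) →ₗ[K] (List X →₀ K) :=
  Finsupp.lmapDomain K K (List.cons x)

/-- The boundary of a single tuple of points; the empty tuple spans the chains in degree `-1`. -/
noncomputable def bdryList : List X → (List X →₀ K)
  | [] => 0
  | x :: l => Finsupp.single l 1 - cone K x (bdryList l)

/-- The boundary operator on ordered chains. -/
noncomputable def bdry : (List X →₀ K) →ₗ[K] (List X →₀ K) :=
  Finsupp.linearCombination K (bdryList K)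

/-- The map induced on ordered chains by a map of points. -/
noncomputable def mapChain (f : X → Y) : (List X →₀ K) →ₗ[K] (List Y →₀ K) :=
  Finsupp.lmapDomain K K (List.map f)

/-- The prism over a tuple, as a homotopy between the maps induced by `f` and `g`. -/
noncomputable def prismList (f g : X → Y) : List X → (List Y →₀ K)
  | [] => 0
  | x :: l => cone K (f x) (cone K (g x) (Finsupp.single (l.map g) 1)) -
      cone K (f x) (prismList f g l)

/-- The prism operator between the maps induced by `f` and `g`. -/
noncomputable def prism (f g : X → Y) : (List X →₀ K) →ₗ[K] (List Y →₀ K) :=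
  Finsupp.linearCombination K (prismList K f g)

@[simp] lemma cone_single (x : X) (l : List X) (a : K) :
    cone K x (Finsupp.single l a) = Finsupp.single (x :: l) a := by
  simp [cone, Finsupp.mapDomain_single]

@[simp] lemma mapChain_single (f : X → Y) (l : List X) (a : K) :
    mapChain K f (Finsupp.single l a) = Finsupp.single (l.map f) a := by
  simp [mapChain, Finsupp.mapDomain_single]

lemma bdry_single (l : List X) : bdry K (Finsupp.single l 1) = bdryList K l := by
  simp [bdry]

lemma prism_single (f g : X → Y) (l : List X) :
    prism K f g (Finsupp.single l 1) = prismList K f g l := by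
  simp [prism]

variable {K}

lemma ext_single {M : Type*} [AddCommGroup M] [Module K M] {ι : Type*} {f g : (ι →₀ K) →ₗ[K] M}
    (h : ∀ i, f (Finsupp.single i 1) = g (Finsupp.single i 1)) (c : ι →₀ K) : f c = g c :=
  map_eq_of_mem_supported (T := Set.univ) (fun i _ => h i) (by simp)

lemma eq_zero_of_single {M : Type*} [AddCommGroup M] [Module K M] {ι : Type*}
    {f : (ι →₀ K) →ₗ[K] M} (h : ∀ i, f (Finsupp.single i 1) = 0) (c : ι →₀ K) : f c = 0 := by
  rw [ext_single (f := f) (g := 0) (fun i => by rw [h, LinearMap.zero_apply]) c,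
    LinearMap.zero_apply]

lemma bdry_cone (x : X) (c : List X →₀ K) :
    bdry K (cone K x c) = c - cone K x (bdry K c) := by
  refine ext_single (f := bdry K ∘ₗ cone K x) (g := LinearMap.id - cone K x ∘ₗ bdry K) ?_ c
  intro l
  simp [bdry_single, bdryList]

lemma mapChain_cone (f : X → Y) (x : X) (c : List X →₀ K) :
    mapChain K f (cone K x c) = cone K (f x) (mapChain K f c) := by
  refine ext_single (f := mapChain K f ∘ₗ cone K x) (g := cone K (f x) ∘ₗ mapChain K f) ?_ c
  intro l
  simp

lemma prism_cone (f g : X → Y) (x : X) (c : List X →₀ K) :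
    prism K f g (cone K x c) =
      cone K (f x) (cone K (g x) (mapChain K g c)) - cone K (f x) (prism K f g c) := by
  refine ext_single (f := prism K f g ∘ₗ cone K x)
    (g := cone K (f x) ∘ₗ cone K (g x) ∘ₗ mapChain K g - cone K (f x) ∘ₗ prism K f g) ?_ c
  intro l
  simp [prism_single, prismList]

lemma bdry_bdry (c : List X →₀ K) : bdry K (bdry K c) = 0 := by
  refine ext_single (f := bdry K ∘ₗ bdry K) (g := 0) ?_ c
  intro l
  simp only [LinearMap.comp_apply, LinearMap.zero_apply, bdry_single]
  induction l with
  | nil => simp [bdryList]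
  | cons x l ih => simp [bdryList, bdry_cone, bdry_single, ih]

lemma bdry_mapChain (f : X → Y) (c : List X →₀ K) :
    bdry K (mapChain K f c) = mapChain K f (bdry K c) := by
  refine ext_single (f := bdry K ∘ₗ mapChain K f) (g := mapChain K f ∘ₗ bdry K) ?_ c
  intro l
  simp only [LinearMap.comp_apply, bdry_single, mapChain_single]
  induction l with
  | nil => simp [bdryList]
  | cons x l ih => simp [bdryList, mapChain_cone, ih]

lemma bdry_prism (f g : X → Y) (c : List X →₀ K) :
    bdry K (prism K f g c) = mapChain K g c - mapChain K f c - prism K f g (bdry K c) := by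
  refine ext_single (f := bdry K ∘ₗ prism K f g)
    (g := mapChain K g - mapChain K f - prism K f g ∘ₗ bdry K) ?_ c
  intro l
  simp only [LinearMap.comp_apply, bdry_single, mapChain_single, LinearMap.sub_apply, prism_single]
  induction l with
  | nil => simp [bdryList, prismList]
  | cons x l ih =>
    have h1 := bdry_mapChain g (Finsupp.single l (1 : K))
    simp only [mapChain_single, bdry_single] at h1
    simp only [bdryList, prismList, map_sub, bdry_cone, bdry_single, ih, h1, prism_single,
      prism_cone, cone_single, List.map_cons]
    abel

lemma bdryList_mem (l : List X) :
    bdryList K l ∈ Finsupp.supported K K {m | m.Sublist l ∧ m.length + 1 = l.length} := by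
  induction l with
  | nil => simp [bdryList]
  | cons x l ih =>
    refine Submodule.sub_mem _ (Finsupp.single_mem_supported K 1 (by simp)) ?_
    refine map_mem_of_mem_supported ?_ ih
    rintro m ⟨h1, h2⟩
    rw [cone_single]
    exact Finsupp.single_mem_supported K 1 ⟨h1.cons_cons x, by simp [h2]⟩

lemma prismList_mem (f g : X → Y) (l : List X) :
    prismList K f g l ∈ Finsupp.supported K K {m | ∀ y ∈ m, ∃ x ∈ l, y = f x ∨ y = g x} := by
  induction l with
  | nil => simp [prismList]
  | cons x l ih =>
    refine Submodule.sub_mem _ ?_ ?_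
    · rw [cone_single, cone_single]
      refine Finsupp.single_mem_supported K 1 ?_
      intro y hy
      simp only [List.mem_cons, List.mem_map] at hy
      rcases hy with rfl | rfl | ⟨u, hu, rfl⟩
      · exact ⟨x, by simp⟩
      · exact ⟨x, by simp⟩
      · exact ⟨u, by simp [hu]⟩
    · refine map_mem_of_mem_supported ?_ ih
      intro m hm
      rw [cone_single]
      refine Finsupp.single_mem_supported K 1 ?_
      intro y hy
      rcases List.mem_cons.1 hy with rfl | hy
      · exact ⟨x, by simp⟩
      · obtain ⟨u, hu, h⟩ := hm y hy
        exact ⟨u, by simp [hu], h⟩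

section Small

variable [PseudoMetricSpace X] [PseudoMetricSpace Y]

/-- The tuples of points of `S` of diameter less than `ε`. -/
def smallTuples (S : Set X) (ε : ℝ) : Set (List X) :=
  {l | (∀ x ∈ l, x ∈ S) ∧ ∀ x ∈ l, ∀ y ∈ l, dist x y < ε}

lemma smallTuples_mono {S T : Set X} {ε ε' : ℝ} (h : S ⊆ T) (hε : ε ≤ ε') :
    smallTuples S ε ⊆ smallTuples T ε' :=
  fun _ hl => ⟨fun x hx => h (hl.1 x hx), fun x hx y hy => (hl.2 x hx y hy).trans_le hε⟩

lemma smallTuples_sublist {S : Set X} {ε : ℝ} {l m : List X} (h : m.Sublist l)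
    (hl : l ∈ smallTuples S ε) : m ∈ smallTuples S ε :=
  ⟨fun x hx => hl.1 x (h.subset hx), fun x hx y hy => hl.2 x (h.subset hx) y (h.subset hy)⟩

variable (K)

/-- The chains spanned by the small tuples of points of `S`. -/
noncomputable abbrev Small (S : Set X) (ε : ℝ) : Submodule K (List X →₀ K) :=
  Finsupp.supported K K (smallTuples S ε)

/-- The chains spanned by the tuples of `n` points. -/
noncomputable abbrev OfLength (X : Type*) (n : ℕ) : Submodule K (List X →₀ K) :=
  Finsupp.supported K K {l | l.length = n}

variable {K}

/-- A cycle which can be contracted to a point through sufficiently small steps is a boundary. -/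
lemma exists_primitive_of_contraction {S : Set X} {ε : ℝ} (hε : 0 < ε) {T : Set (List X)}
    (N : ℕ) (f : ℕ → X → X) (p : X) (hp : p ∈ S) (h0 : ∀ l ∈ T, ∀ x ∈ l, f 0 x = x)
    (hN : ∀ l ∈ T, ∀ x ∈ l, f N x = p)
    (hS : ∀ l ∈ T, ∀ x ∈ l, ∀ k ≤ N, f k x ∈ S)
    (hd : ∀ l ∈ T, ∀ x ∈ l, ∀ y ∈ l, ∀ i ≤ N, ∀ j ≤ N, i ≤ j + 1 → j ≤ i + 1 →
      dist (f i x) (f j y) < ε)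
    {z : List X →₀ K} (hz : z ∈ Finsupp.supported K K T) (hcyc : bdry K z = 0) :
    ∃ w ∈ Small K S ε, bdry K w = z := by
  have key : ∀ k ≤ N, ∃ w ∈ Small K S ε, bdry K w = mapChain K (f k) z - z := by
    intro k
    induction k with
    | zero =>
      intro _
      refine ⟨0, Submodule.zero_mem _, ?_⟩
      rw [map_zero, eq_comm, sub_eq_zero]
      refine map_eq_of_mem_supported (f := mapChain K (f 0)) (g := LinearMap.id) ?_ hz
      intro l hl
      rw [mapChain_single, LinearMap.id_apply, List.map_congr_left (h0 l hl), List.map_id']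
    | succ k ih =>
      intro hk
      obtain ⟨w, hw, hw'⟩ := ih (by omega)
      refine ⟨w + prism K (f k) (f (k + 1)) z, Submodule.add_mem _ hw ?_, ?_⟩
      · refine map_mem_of_mem_supported ?_ hz
        intro l hl
        rw [prism_single]
        refine Finsupp.supported_mono ?_ (prismList_mem (f k) (f (k + 1)) l)
        intro m hm
        have hm' : ∀ y ∈ m, ∃ x ∈ l, ∃ i, k ≤ i ∧ i ≤ k + 1 ∧ y = f i x := by
          intro y hy
          obtain ⟨x, hx, h | h⟩ := hm y hy
          · exact ⟨x, hx, k, by omega, by omega, h⟩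
          · exact ⟨x, hx, k + 1, by omega, by omega, h⟩
        constructor
        · intro y hy
          obtain ⟨x, hx, i, h1, h2, rfl⟩ := hm' y hy
          exact hS l hl x hx i (by omega)
        · intro y hy y' hy'
          obtain ⟨x, hx, i, h1, h2, rfl⟩ := hm' y hy
          obtain ⟨x', hx', j, h3, h4, rfl⟩ := hm' y' hy'
          exact hd l hl x hx x' hx' i (by omega) j (by omega) (by omega) (by omega)
      · rw [map_add, hw', bdry_prism, hcyc, map_zero]
        abel
  obtain ⟨w, hw, hw'⟩ := key N le_rfl
  refine ⟨cone K p (mapChain K (f N) z) - w, Submodule.sub_mem _ ?_ hw, ?_⟩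
  · refine map_mem_of_mem_supported (f := cone K p ∘ₗ mapChain K (f N)) ?_ hz
    intro l hl
    have : ∀ y ∈ p :: l.map (f N), y = p := by
      intro y hy
      rcases List.mem_cons.1 hy with rfl | hy
      · rfl
      · obtain ⟨x, hx, rfl⟩ := List.mem_map.1 hy
        exact hN l hl x hx
    rw [LinearMap.comp_apply, mapChain_single, cone_single]
    refine Finsupp.single_mem_supported K 1 ⟨fun y hy => this y hy ▸ hp, fun y hy y' hy' => ?_⟩
    rw [this y hy, this y' hy', dist_self]
    exact hε
  · rw [map_sub, bdry_cone, hw', bdry_mapChain, hcyc]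
    simp

variable (K) in
/-- Cycles of tuples of `n` points of `S` bound small chains, provided they are small enough. -/
def Triv (S : Set X) (n : ℕ) : Prop :=
  ∀ ε > 0, ∃ δ > 0, ∀ z ∈ Small K S δ ⊓ OfLength K X n, bdry K z = 0 →
    ∃ w ∈ Small K S ε, bdry K w = z

lemma mapChain_mem {S : Set X} {T : Set Y} {f : X → Y} (hf : Set.MapsTo f S T) {δ ε : ℝ}
    (h : ∀ x ∈ S, ∀ y ∈ S, dist x y < δ → dist (f x) (f y) < ε) {z : List X →₀ K}
    (hz : z ∈ Small K S δ) : mapChain K f z ∈ Small K T ε := by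
  refine map_mem_of_mem_supported ?_ hz
  intro l hl
  rw [mapChain_single]
  refine Finsupp.single_mem_supported K 1 ⟨?_, ?_⟩
  · simp only [List.mem_map]
    rintro y ⟨x, hx, rfl⟩
    exact hf (hl.1 x hx)
  · simp only [List.mem_map]
    rintro y ⟨x, hx, rfl⟩ y' ⟨x', hx', rfl⟩
    exact h x (hl.1 x hx) x' (hl.1 x' hx') (hl.2 x hx x' hx')

/-- Triviality passes to uniformly continuous retracts. -/
lemma Triv.retract {S : Set X} {T : Set Y} {n : ℕ} (hT : Triv K T n) {f : X → Y} {g : Y → X}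
    (hf : Set.MapsTo f S T) (hg : Set.MapsTo g T S) (hfu : UniformContinuousOn f S)
    (hgu : UniformContinuousOn g T) (hgf : ∀ x ∈ S, g (f x) = x) : Triv K S n := by
  rw [Metric.uniformContinuousOn_iff] at hfu hgu
  intro ε hε
  obtain ⟨ε₁, hε₁, h1⟩ := hgu ε hε
  obtain ⟨δ₁, hδ₁, h2⟩ := hT ε₁ hε₁
  obtain ⟨δ, hδ, h3⟩ := hfu δ₁ hδ₁
  refine ⟨δ, hδ, ?_⟩
  rintro z ⟨hz, hzn⟩ hcyc
  have hlen : mapChain K f z ∈ OfLength K Y n := by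
    refine map_mem_of_mem_supported ?_ hzn
    intro l hl
    rw [mapChain_single]
    exact Finsupp.single_mem_supported K 1 (by simpa using hl)
  obtain ⟨w, hw, hw'⟩ := h2 (mapChain K f z) ⟨mapChain_mem hf h3 hz, hlen⟩
    (by rw [bdry_mapChain, hcyc, map_zero])
  refine ⟨mapChain K g w, mapChain_mem hg h1 hw, ?_⟩
  rw [bdry_mapChain, hw']
  refine map_eq_of_mem_supported (f := mapChain K g ∘ₗ mapChain K f) (g := LinearMap.id) ?_ hz
  intro l hl
  rw [LinearMap.comp_apply, mapChain_single, mapChain_single, List.map_map, LinearMap.id_apply,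
    List.map_congr_left (f := g ∘ f) (g := id) (fun x hx => hgf x (hl.1 x hx)), List.map_id]

end Small

end ListChain

/-! ### Augmented oriented chains on the full simplex -/

namespace FaceChain

variable (K : Type*) [Field K] {V : Type*} [LinearOrder V]

/-- The sign of moving `w` past `v`: it is `-1` if `w < v` and `1` otherwise. -/
def transpSign (w v : V) : K := if w < v then -1 else 1

/-- The sign of moving `v` to its place in the ordered set `σ`. -/
def sg (v : V) (σ : Finset V) : K := ∏ w ∈ σ, transpSign K w v

lemma sg_eq (v : V) (σ : Finset V) : sg K v σ = (-1) ^ (σ.filter (fun w => w < v)).card := by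
  simp [sg, transpSign, Finset.prod_ite]

/-- The oriented boundary operator on the chains of the full simplex on `V`. -/
noncomputable def bd : (Finset V →₀ K) →ₗ[K] (Finset V →₀ K) :=
  Finsupp.linearCombination K fun σ => ∑ v ∈ σ, Finsupp.single (σ.erase v) (sg K v σ)

/-- The oriented join with the vertex `v`. -/
noncomputable def wedge (v : V) : (Finset V →₀ K) →ₗ[K] (Finset V →₀ K) :=
  Finsupp.linearCombination K fun σ =>
    if v ∈ σ then 0 else Finsupp.single (insert v σ) (sg K v σ)

lemma bd_single (σ : Finset V) :
    bd K (Finsupp.single σ 1) = ∑ v ∈ σ, Finsupp.single (σ.erase v) (sg K v σ) := by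
  simp [bd]

variable {K}

lemma wedge_of_mem {v : V} {σ : Finset V} (h : v ∈ σ) (a : K) :
    wedge K v (Finsupp.single σ a) = 0 := by
  simp [wedge, h]

lemma wedge_of_notMem {v : V} {σ : Finset V} (h : v ∉ σ) (a : K) :
    wedge K v (Finsupp.single σ a) = Finsupp.single (insert v σ) (a * sg K v σ) := by
  simp [wedge, h]

lemma transpSign_mul {v w : V} (h : v ≠ w) : transpSign K w v * transpSign K v w = -1 := by
  unfold transpSign
  rcases lt_or_gt_of_ne h with h' | h'
  · simp [h', h'.not_gt]
  · simp [h', h'.not_gt]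

lemma transpSign_mul_self (v w : V) : transpSign K w v * transpSign K w v = 1 := by
  unfold transpSign
  split_ifs <;> simp

lemma sg_mul_self (v : V) (σ : Finset V) : sg K v σ * sg K v σ = 1 := by
  simp [sg, ← Finset.prod_mul_distrib, transpSign_mul_self]

lemma sg_insert {v w : V} {σ : Finset V} (h : w ∉ σ) :
    sg K v (insert w σ) = transpSign K w v * sg K v σ := by
  simp [sg, Finset.prod_insert h]

lemma sg_insert_self (v : V) (σ : Finset V) : sg K v (insert v σ) = sg K v σ := by
  by_cases h : v ∈ σ
  · simp [h]
  · simp [sg_insert h, transpSign]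

lemma sg_erase_self (v : V) (σ : Finset V) : sg K v (σ.erase v) = sg K v σ := by
  by_cases h : v ∈ σ
  · rw [← sg_insert_self v (σ.erase v), Finset.insert_erase h]
  · rw [Finset.erase_eq_of_notMem h]

lemma bd_wedge (v : V) (c : Finset V →₀ K) : bd K (wedge K v c) = c - wedge K v (bd K c) := by
  refine ListChain.ext_single (f := bd K ∘ₗ wedge K v)
    (g := LinearMap.id - wedge K v ∘ₗ bd K) ?_ c
  intro σ
  simp only [LinearMap.comp_apply, LinearMap.sub_apply, LinearMap.id_apply]
  by_cases h : v ∈ σ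
  · rw [wedge_of_mem h, map_zero, bd_single, map_sum, Finset.sum_eq_single_of_mem v h,
      wedge_of_notMem (Finset.notMem_erase v σ), Finset.insert_erase h, sg_erase_self, sg_mul_self,
      sub_self]
    intro u _ huv
    exact wedge_of_mem (Finset.mem_erase.2 ⟨huv.symm, h⟩) _
  · rw [wedge_of_notMem h, one_mul, ← mul_one (sg K v σ), ← smul_eq_mul, ← Finsupp.smul_single,
      map_smul, bd_single, Finset.sum_insert h, smul_add, Finset.erase_insert h, sg_insert_self,
      Finsupp.smul_single, smul_eq_mul, sg_mul_self, bd_single, map_sum, sub_eq_add_neg,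
      ← Finset.sum_neg_distrib, Finset.smul_sum]
    congr 1
    refine Finset.sum_congr rfl fun u hu => ?_
    have huv : u ≠ v := fun e => h (e ▸ hu)
    have hv : v ∉ σ.erase u := fun e => h (Finset.mem_of_mem_erase e)
    rw [wedge_of_notMem hv, Finset.erase_insert_of_ne huv.symm, Finsupp.smul_single, smul_eq_mul,
      ← Finsupp.single_neg, sg_insert h]
    congr 1
    have h1 : sg K v σ = transpSign K u v * sg K v (σ.erase u) := by
      conv_lhs => rw [← Finset.insert_erase hu]
      exact sg_insert (Finset.notMem_erase u σ)
    have h2 := transpSign_mul (K := K) huv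
    rw [h1]
    linear_combination sg K v (σ.erase u) * sg K u σ * h2

lemma bd_bd (c : Finset V →₀ K) : bd K (bd K c) = 0 := by
  rw [← LinearMap.comp_apply]
  refine ListChain.eq_zero_of_single (fun σ => ?_) c
  rw [LinearMap.comp_apply]
  induction σ using Finset.induction_on with
  | empty => simp [bd_single]
  | insert v σ h ih =>
    have h1 : Finsupp.single (insert v σ) (1 : K) =
        sg K v σ • wedge K v (Finsupp.single σ 1) := by
      rw [wedge_of_notMem h, one_mul, Finsupp.smul_single, smul_eq_mul, sg_mul_self]
    rw [h1, map_smul, map_smul, bd_wedge, map_sub, bd_wedge, ih]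
    simp

lemma bd_single_mem (σ : Finset V) : bd K (Finsupp.single σ 1) ∈
    Finsupp.supported K K {τ | τ ⊆ σ ∧ τ.card + 1 = σ.card} := by
  rw [bd_single]
  refine Submodule.sum_mem _ fun v hv => Finsupp.single_mem_supported K _ ⟨σ.erase_subset v, ?_⟩
  exact Finset.card_erase_add_one hv

lemma bd_single_ne_zero {σ : Finset V} (h : σ.Nonempty) : bd K (Finsupp.single σ (1 : K)) ≠ 0 := by
  obtain ⟨v, hv⟩ := h
  intro h0
  have h1 := bd_wedge v (Finsupp.single σ (1 : K))
  rw [wedge_of_mem hv, h0, map_zero, map_zero, sub_zero] at h1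
  exact one_ne_zero (Finsupp.single_eq_zero.1 h1.symm)

variable (K)

/-- The vertices of a tuple, as the oriented simplex they span. -/
noncomputable def spanList {X : Type*} (ν : X → V) : List X → (Finset V →₀ K)
  | [] => Finsupp.single ∅ 1
  | x :: l => wedge K (ν x) (spanList ν l)

/-- The chain map from ordered chains to oriented chains induced by a map to the vertices. -/
noncomputable def orient {X : Type*} (ν : X → V) : (List X →₀ K) →ₗ[K] (Finset V →₀ K) :=
  Finsupp.linearCombination K (spanList K ν)

variable {K}

lemma orient_single {X : Type*} (ν : X → V) (l : List X) :
    orient K ν (Finsupp.single l 1) = spanList K ν l := by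
  simp [orient]

lemma orient_cone {X : Type*} (ν : X → V) (x : X) (c : List X →₀ K) :
    orient K ν (ListChain.cone K x c) = wedge K (ν x) (orient K ν c) := by
  refine ListChain.ext_single (f := orient K ν ∘ₗ ListChain.cone K x)
    (g := wedge K (ν x) ∘ₗ orient K ν) ?_ c
  intro l
  simp [orient_single, spanList]

lemma bd_orient {X : Type*} (ν : X → V) (c : List X →₀ K) :
    bd K (orient K ν c) = orient K ν (ListChain.bdry K c) := by
  refine ListChain.ext_single (f := bd K ∘ₗ orient K ν)
    (g := orient K ν ∘ₗ ListChain.bdry K) ?_ c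
  intro l
  simp only [LinearMap.comp_apply, orient_single, ListChain.bdry_single]
  induction l with
  | nil => simp [spanList, ListChain.bdryList, bd_single]
  | cons x l ih =>
    simp only [spanList, ListChain.bdryList, bd_wedge, map_sub, orient_cone, orient_single, ih]

lemma spanList_mem {X : Type*} (ν : X → V) (l : List X) : spanList K ν l ∈
    Finsupp.supported K K {τ | τ ⊆ (l.map ν).toFinset ∧ τ.card = l.length} := by
  induction l with
  | nil => exact Finsupp.single_mem_supported K 1 (by simp)
  | cons x l ih =>
    refine map_mem_of_mem_supported ?_ ih
    rintro τ ⟨h1, h2⟩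
    by_cases h : ν x ∈ τ
    · rw [wedge_of_mem h]
      exact Submodule.zero_mem _
    · rw [wedge_of_notMem h]
      refine Finsupp.single_mem_supported K _ ⟨?_, ?_⟩
      · simp only [List.map_cons, List.toFinset_cons]
        exact Finset.insert_subset_insert _ h1
      · rw [Finset.card_insert_of_notMem h, h2, List.length_cons]

end FaceChain

namespace ListChain

variable {K : Type*} [Field K]

/-- Small cycles in a star-shaped set bound. -/
lemma exists_primitive_of_starConvex {E : Type*} [NormedAddCommGroup E] [NormedSpace ℝ E]
    {S : Set E} {p : E} (hp : p ∈ S) (hS : StarConvex ℝ p S) {ε : ℝ} (hε : 0 < ε)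
    {z : List E →₀ K} (hz : z ∈ Small K S ε) (hcyc : bdry K z = 0) :
    ∃ w ∈ Small K S ε, bdry K w = z := by
  have hz' := (Finsupp.mem_supported K z).1 hz
  have hN : ∀ᶠ N : ℕ in Filter.atTop, ∀ l ∈ z.support, ∀ x ∈ l, ∀ y ∈ l,
      dist x y + (1 / (N : ℝ)) * dist p y < ε := by
    rw [Filter.eventually_all_finset]
    intro l hl
    have hfin := List.finite_toSet l
    refine (Filter.eventually_all_finite hfin).2 fun x hx => ?_
    refine (Filter.eventually_all_finite hfin).2 fun y hy => ?_
    have ht : Filter.Tendsto (fun N : ℕ => dist x y + (1 / (N : ℝ)) * dist p y) Filter.atTop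
        (nhds (dist x y + 0 * dist p y)) :=
      tendsto_const_nhds.add (tendsto_one_div_atTop_nhds_zero_nat.mul_const _)
    refine ht.eventually_lt_const ?_
    rw [zero_mul, add_zero]
    exact (hz' hl).2 x hx y hy
  obtain ⟨N, hN, hN0⟩ := (hN.and (Filter.eventually_gt_atTop 0)).exists
  have hN0' : (0 : ℝ) < N := by exact_mod_cast hN0
  refine exists_primitive_of_contraction hε (T := (z.support : Set (List E))) N
    (fun k x => x + ((k : ℝ) / N) • (p - x)) p hp ?_ ?_ ?_ ?_
    ((Finsupp.mem_supported K z).2 subset_rfl) hcyc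
  · intro l _ x _
    simp
  · intro l _ x _
    simp [hN0'.ne']
  · intro l hl x hx k hk
    have h1 : (k : ℝ) / N ≤ 1 := by
      rw [div_le_one hN0']; exact_mod_cast hk
    have h2 := hS ((hz' hl).1 x hx) (a := (k : ℝ) / N) (b := 1 - (k : ℝ) / N) (by positivity)
      (by linarith) (by ring)
    convert h2 using 1
    module
  · intro l hl x hx y hy i hi j hj hij hji
    refine lt_of_le_of_lt ?_ (hN l hl x hx y hy)
    have h1 : (i : ℝ) / N ≤ 1 := by
      rw [div_le_one hN0']; exact_mod_cast hi
    have h0 : 0 ≤ (i : ℝ) / N := by positivity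
    have h3 : |(i : ℝ) / N - j / N| ≤ 1 / N := by
      rw [← sub_div, abs_div, abs_of_pos hN0']
      gcongr
      rw [abs_le]
      constructor
      · have : (j : ℝ) ≤ i + 1 := by exact_mod_cast hji
        linarith
      · have : (i : ℝ) ≤ j + 1 := by exact_mod_cast hij
        linarith
    rw [dist_eq_norm, dist_eq_norm, dist_eq_norm]
    have h4 : x + ((i : ℝ) / N) • (p - x) - (y + ((j : ℝ) / N) • (p - y)) =
        (1 - (i : ℝ) / N) • (x - y) + ((i : ℝ) / N - j / N) • (p - y) := by module
    rw [h4]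
    refine (norm_add_le _ _).trans ?_
    rw [norm_smul, norm_smul, Real.norm_eq_abs, Real.norm_eq_abs]
    refine add_le_add ?_ (mul_le_mul_of_nonneg_right h3 (norm_nonneg _))
    refine mul_le_of_le_one_left (norm_nonneg _) ?_
    rw [abs_le]
    constructor <;> linarith

/-- Acyclic carriers: a chain map which vanishes on the empty tuple and is carried by acyclic
submodules is null-homotopic. -/
lemma exists_homotopy {X : Type*} {F : (List X →₀ K) →ₗ[K] (List X →₀ K)}
    (hF : ∀ c, bdry K (F c) = F (bdry K c)) (hF0 : F (Finsupp.single [] 1) = 0)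
    {T : Set (List X)} (hT : ∀ l ∈ T, ∀ m : List X, m.Sublist l → m ∈ T)
    (S : List X → Submodule K (List X →₀ K)) (hS : ∀ l m : List X, m.Sublist l → S m ≤ S l)
    (hFS : ∀ l ∈ T, F (Finsupp.single l 1) ∈ S l)
    (hac : ∀ l ∈ T, l ≠ [] → ∀ z ∈ S l, bdry K z = 0 → ∃ w ∈ S l, bdry K w = z) (n : ℕ) :
    ∃ h : (List X →₀ K) →ₗ[K] (List X →₀ K), ∀ l ∈ T, l.length ≤ n →
      h (Finsupp.single l 1) ∈ S l ∧
      bdry K (h (Finsupp.single l 1)) =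
        F (Finsupp.single l 1) - h (bdry K (Finsupp.single l 1)) := by
  induction n with
  | zero =>
    refine ⟨0, fun l _ hl => ?_⟩
    obtain rfl : l = [] := List.length_eq_zero_iff.1 (by omega)
    simp [hF0]
  | succ n ih =>
    obtain ⟨h, hh⟩ := ih
    have hex : ∀ l : List X, ∃ c, l ∈ T → l.length = n + 1 → c ∈ S l ∧
        bdry K c = F (Finsupp.single l 1) - h (bdry K (Finsupp.single l 1)) := by
      intro l
      by_cases hl : l ∈ T ∧ l.length = n + 1
      swap
      · exact ⟨0, fun h1 h2 => absurd ⟨h1, h2⟩ hl⟩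
      obtain ⟨hlT, hln⟩ := hl
      have hmem := bdryList_mem (K := K) l
      rw [← bdry_single] at hmem
      have h1 : h (bdry K (Finsupp.single l 1)) ∈ S l := by
        refine map_mem_of_mem_supported ?_ hmem
        rintro m ⟨hm, hm'⟩
        exact hS l m hm (hh m (hT l hlT m hm) (by omega)).1
      have h2 : bdry K (h (bdry K (Finsupp.single l 1))) = F (bdry K (Finsupp.single l 1)) := by
        have := map_eq_of_mem_supported (f := bdry K ∘ₗ h) (g := F - h ∘ₗ bdry K)
          (by
            rintro m ⟨hm, hm'⟩
            exact (hh m (hT l hlT m hm) (by omega)).2) hmem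
        simpa [bdry_bdry] using this
      obtain ⟨w, hw, hw'⟩ := hac l hlT (by rintro rfl; simp at hln)
        (F (Finsupp.single l 1) - h (bdry K (Finsupp.single l 1)))
        ((S l).sub_mem (hFS l hlT) h1) (by rw [map_sub, h2, hF, sub_self])
      exact ⟨w, fun _ _ => ⟨hw, hw'⟩⟩
    choose c hc using hex
    let h' : (List X →₀ K) →ₗ[K] (List X →₀ K) := Finsupp.linearCombination K fun l =>
      if l.length = n + 1 then c l else h (Finsupp.single l 1)
    have hs : ∀ l, h' (Finsupp.single l 1) =
        if l.length = n + 1 then c l else h (Finsupp.single l 1) := fun l => by simp [h']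
    refine ⟨h', fun l hl hln => ?_⟩
    have hb : h' (bdry K (Finsupp.single l 1)) = h (bdry K (Finsupp.single l 1)) := by
      have hmem := bdryList_mem (K := K) l
      rw [← bdry_single] at hmem
      refine map_eq_of_mem_supported ?_ hmem
      rintro m ⟨_, hm'⟩
      rw [hs, if_neg (by omega)]
    rw [hb, hs]
    split_ifs with hl'
    · exact hc l hl hl'
    · exact hh l hl (by omega)

end ListChain

namespace ASC

variable {V : Type} [Fintype V]

/-- The closed simplex with vertex set `σ` in the space of weight functions on `V`. -/
def faceSet (σ : Finset V) : Set (V → ℝ) :=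
  {x | (∀ v, 0 ≤ x v) ∧ (∑ v, x v) = 1 ∧ ∀ v, x v ≠ 0 → v ∈ σ}

lemma faceSet_mono {σ τ : Finset V} (h : σ ⊆ τ) : faceSet σ ⊆ faceSet τ :=
  fun _ hx => ⟨hx.1, hx.2.1, fun v hv => h (hx.2.2 v hv)⟩

lemma faceSet_subset_realization {Γ : ASC V} {σ : Finset V} (hσ : σ ∈ Γ.faces) :
    faceSet σ ⊆ Γ.realization := by
  classical
  intro x hx
  refine ⟨hx.1, hx.2.1, univ.filter (fun v => x v ≠ 0), Γ.down_closed hσ ?_, by simp⟩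
  intro v hv
  exact hx.2.2 v (by simpa using hv)

lemma mem_realization_iff {Γ : ASC V} {x : V → ℝ} :
    x ∈ Γ.realization ↔ ∃ σ ∈ Γ.faces, x ∈ faceSet σ :=
  ⟨fun ⟨h0, h1, σ, hσ, h⟩ => ⟨σ, hσ, h0, h1, fun v => (h v).1⟩,
    fun ⟨_, hσ, hx⟩ => faceSet_subset_realization hσ hx⟩

lemma convex_faceSet (σ : Finset V) : Convex ℝ (faceSet σ) := by
  intro x hx y hy a b ha hb hab
  refine ⟨fun v => ?_, ?_, fun v hv => ?_⟩
  · have := hx.1 v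
    have := hy.1 v
    simp only [Pi.add_apply, Pi.smul_apply, smul_eq_mul]
    positivity
  · simp only [Pi.add_apply, Pi.smul_apply, smul_eq_mul, Finset.sum_add_distrib, ← Finset.mul_sum,
      hx.2.1, hy.2.1]
    linarith
  · by_contra h
    have h1 : x v = 0 := by by_contra h'; exact h (hx.2.2 v h')
    have h2 : y v = 0 := by by_contra h'; exact h (hy.2.2 v h')
    simp [h1, h2] at hv

lemma single_mem_faceSet [DecidableEq V] {σ : Finset V} {v : V} (hv : v ∈ σ) :
    (Pi.single v 1 : V → ℝ) ∈ faceSet σ := by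
  refine ⟨fun w => ?_, by simp, fun w hw => ?_⟩
  · by_cases h : w = v
    · subst h; simp
    · simp [h]
  · by_contra h
    exact hw (Pi.single_eq_of_ne (fun e => h (by rw [e]; exact hv)) _)

/-- Every point of the standard simplex has a coordinate of size at least `1 / |V|`. -/
lemma exists_vertexMap (V : Type) [Fintype V] [Nonempty V] :
    ∃ ν : (V → ℝ) → V, ∀ x : V → ℝ, ∑ v, x v = 1 → 1 / (Fintype.card V : ℝ) ≤ x (ν x) := by
  have : ∀ x : V → ℝ, ∃ v, ∑ v, x v = 1 → 1 / (Fintype.card V : ℝ) ≤ x v := by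
    intro x
    by_contra! hcon
    have hx := (hcon (Classical.arbitrary V)).1
    have hlt : ∑ v, x v < ∑ _v : V, 1 / (Fintype.card V : ℝ) :=
      Finset.sum_lt_sum_of_nonempty univ_nonempty fun v _ => (hcon v).2
    rw [hx] at hlt
    simp at hlt
  exact ⟨fun x => (this x).choose, fun x => (this x).choose_spec⟩

lemma mem_of_mem_faceSet {ν : (V → ℝ) → V}
    (hν : ∀ x : V → ℝ, ∑ v, x v = 1 → 1 / (Fintype.card V : ℝ) ≤ x (ν x))
    {σ : Finset V} {x y : V → ℝ} (hx : ∑ v, x v = 1) (hy : y ∈ faceSet σ)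
    (hd : dist x y < 1 / (Fintype.card V : ℝ)) : ν x ∈ σ := by
  refine hy.2.2 _ fun h0 => ?_
  have h1 := dist_le_pi_dist x y (ν x)
  rw [Real.dist_eq, h0, sub_zero] at h1
  have := hν x hx
  have := le_abs_self (x (ν x))
  linarith

section Approximation

open ListChain FaceChain

variable [LinearOrder V] {K : Type*} [Field K]

variable (K) in
/-- Oriented chains can be subdivided into small ordered chains of points. -/
lemma exists_subdivision {ε : ℝ} (hε : 0 < ε) :
    ∃ s : (Finset V →₀ K) →ₗ[K] (List (V → ℝ) →₀ K),
      s (Finsupp.single ∅ 1) = Finsupp.single [] 1 ∧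
      (∀ σ : Finset V, s (Finsupp.single σ 1) ∈
        Finsupp.supported K K (smallTuples (faceSet σ) ε ∩ {l | l.length = σ.card})) ∧
      ∀ c, bdry K (s c) = s (bd K c) := by
  have key : ∀ n : ℕ, ∃ s : (Finset V →₀ K) →ₗ[K] (List (V → ℝ) →₀ K),
      s (Finsupp.single ∅ 1) = Finsupp.single [] 1 ∧ ∀ σ : Finset V, σ.card ≤ n →
        s (Finsupp.single σ 1) ∈
          Finsupp.supported K K (smallTuples (faceSet σ) ε ∩ {l | l.length = σ.card}) ∧
        bdry K (s (Finsupp.single σ 1)) = s (bd K (Finsupp.single σ 1)) := by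
    intro n
    induction n with
    | zero =>
      refine ⟨Finsupp.linearCombination K fun _ => Finsupp.single [] 1, by simp, fun σ hσ => ?_⟩
      obtain rfl : σ = ∅ := Finset.card_eq_zero.1 (by omega)
      refine ⟨?_, by simp [bdry_single, bdryList, bd_single]⟩
      rw [Finsupp.linearCombination_single, one_smul]
      exact Finsupp.single_mem_supported K 1 (by simp [smallTuples])
    | succ n ih =>
      obtain ⟨s, hs0, hs⟩ := ih
      have hex : ∀ σ : Finset V, ∃ c, σ.card = n + 1 →
          c ∈ Finsupp.supported K K (smallTuples (faceSet σ) ε ∩ {l | l.length = σ.card}) ∧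
          bdry K c = s (bd K (Finsupp.single σ 1)) := by
        intro σ
        by_cases hσ : σ.card = n + 1
        swap
        · exact ⟨0, fun h => absurd h hσ⟩
        have hmem := bd_single_mem (K := K) σ
        have h1 : s (bd K (Finsupp.single σ 1)) ∈
            Finsupp.supported K K (smallTuples (faceSet σ) ε ∩ {l | l.length = n}) := by
          refine map_mem_of_mem_supported ?_ hmem
          rintro τ ⟨hτ, hτ'⟩
          refine Finsupp.supported_mono ?_ (hs τ (by omega)).1
          refine Set.inter_subset_inter (smallTuples_mono (faceSet_mono hτ) le_rfl) ?_
          intro l hl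
          simp only [Set.mem_ofPred_eq] at hl ⊢
          omega
        have h2 : bdry K (s (bd K (Finsupp.single σ 1))) = 0 := by
          have := map_eq_of_mem_supported (f := bdry K ∘ₗ s) (g := s ∘ₗ bd K)
            (fun τ hτ => (hs τ (by have := hτ.2; omega)).2) hmem
          rw [LinearMap.comp_apply, LinearMap.comp_apply, bd_bd, map_zero] at this
          exact this
        obtain ⟨v, hv⟩ : σ.Nonempty := Finset.card_pos.1 (by omega)
        have hv' := single_mem_faceSet hv
        obtain ⟨w, hw, hw'⟩ := exists_primitive_of_starConvex hv'
          ((convex_faceSet σ).starConvex hv') hε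
          (Finsupp.supported_mono Set.inter_subset_left h1) h2
        obtain ⟨w', hw1, hw2⟩ := exists_homogeneous_primitive List.length (bdry K)
          (fun l => Finsupp.supported_mono (fun m hm => hm.2) (bdry_single K l ▸ bdryList_mem l))
          (Finsupp.supported_mono Set.inter_subset_right h1) hw hw'
        exact ⟨w', fun _ => ⟨by rwa [hσ], hw2⟩⟩
      choose c hc using hex
      let s' : (Finset V →₀ K) →ₗ[K] (List (V → ℝ) →₀ K) := Finsupp.linearCombination K fun σ =>
        if σ.card = n + 1 then c σ else s (Finsupp.single σ 1)
      have hs' : ∀ σ, s' (Finsupp.single σ 1) =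
          if σ.card = n + 1 then c σ else s (Finsupp.single σ 1) := fun σ => by simp [s']
      refine ⟨s', by rw [hs', if_neg (by simp), hs0], fun σ hσ => ?_⟩
      have hb : s' (bd K (Finsupp.single σ 1)) = s (bd K (Finsupp.single σ 1)) := by
        refine map_eq_of_mem_supported ?_ (bd_single_mem (K := K) σ)
        rintro τ ⟨_, hτ⟩
        rw [hs', if_neg (by omega)]
      rw [hb, hs']
      split_ifs with hn
      · exact hc σ hn
      · exact hs σ (by omega)
  obtain ⟨s, hs0, hs⟩ := key (Fintype.card V)
  refine ⟨s, hs0, fun σ => (hs σ σ.card_le_univ).1, fun c => ?_⟩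
  exact ext_single (f := bdry K ∘ₗ s) (g := s ∘ₗ bd K) (fun σ => (hs σ σ.card_le_univ).2) c

/-- A vertex map approximating the identity undoes subdivision. -/
lemma orient_subdivision {ν : (V → ℝ) → V}
    (hν : ∀ x : V → ℝ, ∑ v, x v = 1 → 1 / (Fintype.card V : ℝ) ≤ x (ν x)) {ε : ℝ}
    {s : (Finset V →₀ K) →ₗ[K] (List (V → ℝ) →₀ K)}
    (hs0 : s (Finsupp.single ∅ 1) = Finsupp.single [] 1)
    (hs : ∀ σ : Finset V, s (Finsupp.single σ 1) ∈
        Finsupp.supported K K (smallTuples (faceSet σ) ε ∩ {l | l.length = σ.card}))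
    (hsb : ∀ c, bdry K (s c) = s (bd K c)) (c : Finset V →₀ K) : orient K ν (s c) = c := by
  refine ext_single (f := orient K ν ∘ₗ s) (g := LinearMap.id) (fun σ => ?_) c
  rw [LinearMap.comp_apply, LinearMap.id_apply]
  induction hn : σ.card using Nat.strong_induction_on generalizing σ with
  | _ n ih =>
    rcases σ.eq_empty_or_nonempty with rfl | hσ
    · rw [hs0, orient_single, spanList]
    have hmem : orient K ν (s (Finsupp.single σ 1)) ∈ Finsupp.supported K K {σ} := by
      refine map_mem_of_mem_supported ?_ (hs σ)
      rintro l ⟨hl, hl'⟩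
      rw [orient_single]
      refine Finsupp.supported_mono ?_ (spanList_mem ν l)
      rintro τ ⟨h1, h2⟩
      refine Finset.eq_of_subset_of_card_le (h1.trans ?_) (by rw [h2, hl'])
      intro v hv
      obtain ⟨x, hx, rfl⟩ := List.mem_map.1 (List.mem_toFinset.1 hv)
      have hx' := hl.1 x hx
      refine mem_of_mem_faceSet hν hx'.2.1 hx' ?_
      have : Nonempty V := ⟨ν x⟩
      rw [dist_self]
      positivity
    rw [Finsupp.supported_eq_span_single, Set.image_singleton, Submodule.mem_span_singleton] at hmem
    obtain ⟨a, ha⟩ := hmem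
    have h1 : bd K (orient K ν (s (Finsupp.single σ 1))) = bd K (Finsupp.single σ 1) := by
      rw [bd_orient, hsb]
      refine map_eq_of_mem_supported (f := orient K ν ∘ₗ s) (g := LinearMap.id) ?_
        (bd_single_mem (K := K) σ)
      rintro τ ⟨_, hτ⟩
      exact ih τ.card (by omega) τ rfl
    rw [← ha, map_smul] at h1
    have h2 : (a - 1) • bd K (Finsupp.single σ (1 : K)) = 0 := by
      rw [sub_smul, h1, one_smul, sub_self]
    rcases smul_eq_zero.1 h2 with h3 | h3
    · rw [← ha, sub_eq_zero.1 h3, one_smul]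
    · exact absurd h3 (bd_single_ne_zero hσ)

lemma spanList_mem_faces {Γ : ASC V} (h0 : ∅ ∈ Γ.faces) {ν : (V → ℝ) → V}
    (hν : ∀ x : V → ℝ, ∑ v, x v = 1 → 1 / (Fintype.card V : ℝ) ≤ x (ν x)) {l : List (V → ℝ)}
    (hl : l ∈ smallTuples Γ.realization (1 / (Fintype.card V : ℝ))) :
    spanList K ν l ∈ Finsupp.supported K K (Γ.faces ∩ {σ | σ.card = l.length}) := by
  refine Finsupp.supported_mono ?_ (spanList_mem ν l)
  rintro τ ⟨h1, h2⟩
  refine ⟨Γ.down_closed ?_ h1, h2⟩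
  cases l with
  | nil => simpa using h0
  | cons x l =>
    obtain ⟨σ, hσ, hx⟩ := mem_realization_iff.1 (hl.1 x (by simp))
    refine Γ.down_closed hσ fun v hv => ?_
    obtain ⟨y, hy, rfl⟩ := List.mem_map.1 (List.mem_toFinset.1 hv)
    exact mem_of_mem_faceSet hν (hl.1 y hy).2.1 hx (hl.2 y hy x (by simp))

variable (K) in
/-- The reduced homology of `Γ` vanishes on chains of faces with `n` vertices. -/
def AcyclicAt (Γ : ASC V) (n : ℕ) : Prop :=
  ∀ z ∈ Finsupp.supported K K (Γ.faces ∩ {σ | σ.card = n}), bd K z = 0 →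
    ∃ w ∈ Finsupp.supported K K Γ.faces, bd K w = z

variable [Nonempty V]

lemma acyclicAt_of_triv {Γ : ASC V} (h0 : ∅ ∈ Γ.faces) {n : ℕ} (hT : Triv K Γ.realization n) :
    AcyclicAt K Γ n := by
  intro z hz hcyc
  obtain ⟨ν, hν⟩ := exists_vertexMap V
  obtain ⟨δ, hδ, h⟩ := hT (1 / (Fintype.card V : ℝ)) (by positivity)
  obtain ⟨s, hs0, hs, hsb⟩ := exists_subdivision (V := V) K hδ
  have hsz : ∀ σ ∈ Γ.faces ∩ {σ | σ.card = n}, s (Finsupp.single σ 1) ∈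
      Small K Γ.realization δ ⊓ OfLength K (V → ℝ) n := by
    rintro σ ⟨hσ, rfl⟩
    exact ⟨Finsupp.supported_mono (Set.inter_subset_left.trans
      (smallTuples_mono (faceSet_subset_realization hσ) le_rfl)) (hs σ),
      Finsupp.supported_mono Set.inter_subset_right (hs σ)⟩
  obtain ⟨w, hw, hw'⟩ := h (s z) (map_mem_of_mem_supported hsz hz) (by rw [hsb, hcyc, map_zero])
  refine ⟨orient K ν w, map_mem_of_mem_supported ?_ hw, ?_⟩
  · intro l hl
    rw [orient_single]
    exact Finsupp.supported_mono Set.inter_subset_left (spanList_mem_faces h0 hν hl)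
  · rw [bd_orient, hw', orient_subdivision hν hs0 hs hsb]

lemma triv_of_acyclicAt {Γ : ASC V} (h0 : ∅ ∈ Γ.faces) {n : ℕ} (hA : AcyclicAt K Γ n) :
    Triv K Γ.realization n := by
  intro ε hε
  obtain ⟨ν, hν⟩ := exists_vertexMap V
  set δ := min ε (1 / (Fintype.card V : ℝ)) with hδ_def
  have hδ : 0 < δ := lt_min hε (by positivity)
  refine ⟨δ, hδ, ?_⟩
  rintro z ⟨hz, hzn⟩ hcyc
  obtain ⟨s, hs0, hs, hsb⟩ := exists_subdivision (V := V) K hε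
  have hsmall : smallTuples Γ.realization δ ⊆
      smallTuples Γ.realization (1 / (Fintype.card V : ℝ)) :=
    smallTuples_mono subset_rfl (min_le_right _ _)
  have hor : orient K ν z ∈ Finsupp.supported K K (Γ.faces ∩ {σ | σ.card = n}) := by
    have hz' : z ∈ Finsupp.supported K K
        (smallTuples Γ.realization δ ∩ {l | l.length = n}) := by
      rw [Finsupp.supported_inter]
      exact ⟨hz, hzn⟩
    refine map_mem_of_mem_supported ?_ hz'
    rintro l ⟨hl, rfl⟩
    rw [orient_single]
    exact spanList_mem_faces h0 hν (hsmall hl)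
  obtain ⟨u, hu, hu'⟩ := hA _ hor (by rw [bd_orient, hcyc, map_zero])
  let supp : (V → ℝ) → Finset V := fun x => univ.filter fun v => x v ≠ 0
  have hsupp : ∀ x ∈ Γ.realization, x ∈ faceSet (supp x) := fun x hx =>
    ⟨hx.1, hx.2.1, fun v hv => by simpa [supp] using hv⟩
  have hsupp' : ∀ x ∈ Γ.realization, supp x ∈ Γ.faces := by
    intro x hx
    obtain ⟨σ, hσ, hx'⟩ := mem_realization_iff.1 hx
    exact Γ.down_closed hσ fun v hv => hx'.2.2 v (by simpa [supp] using hv)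
  let C : List (V → ℝ) → Set (V → ℝ) := fun l => ⋃ x ∈ l, faceSet (supp x)
  obtain ⟨h, hh⟩ := exists_homotopy (F := LinearMap.id - s ∘ₗ orient K ν)
    (T := smallTuples Γ.realization δ)
    (fun c => by
      simp only [LinearMap.sub_apply, LinearMap.id_apply, LinearMap.comp_apply, map_sub, hsb,
        bd_orient])
    (by simp [orient_single, spanList, hs0])
    (fun l hl m hm => smallTuples_sublist hm hl)
    (fun l => Small K (C l) ε)
    (fun l m hm => Finsupp.supported_mono (smallTuples_mono
      (Set.biUnion_subset_biUnion_left fun x hx => hm.subset hx) le_rfl))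
    (by
      intro l hl
      rw [LinearMap.sub_apply, LinearMap.id_apply, LinearMap.comp_apply, orient_single]
      refine Submodule.sub_mem _ (Finsupp.single_mem_supported K 1 ⟨fun x hx => ?_,
        fun x hx y hy => (hl.2 x hx y hy).trans_le (min_le_left _ _)⟩) ?_
      · exact Set.mem_biUnion hx (hsupp x (hl.1 x hx))
      · cases l with
        | nil =>
          rw [spanList, hs0]
          exact Finsupp.single_mem_supported K 1 (by simp [smallTuples])
        | cons x l =>
          refine map_mem_of_mem_supported ?_ (spanList_mem ν (x :: l))
          rintro τ ⟨hτ, _⟩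
          refine Finsupp.supported_mono (Set.inter_subset_left.trans
            (smallTuples_mono (Set.Subset.trans (faceSet_mono ?_)
              (Set.subset_biUnion_of_mem (u := fun x => faceSet (supp x))
                (show x ∈ {y | y ∈ x :: l} by simp))) le_rfl)) (hs τ)
          intro v hv
          obtain ⟨y, hy, rfl⟩ := List.mem_map.1 (List.mem_toFinset.1 (hτ hv))
          exact mem_of_mem_faceSet hν (hl.1 y hy).2.1 (hsupp x (hl.1 x (by simp)))
            ((hsmall hl).2 y hy x (by simp)))
    (by
      intro l hl hne z hz hcyc
      obtain ⟨x, l, rfl⟩ := List.exists_cons_of_ne_nil hne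
      have hp : ∀ y ∈ x :: l, (Pi.single (ν x) 1 : V → ℝ) ∈ faceSet (supp y) := fun y hy =>
        single_mem_faceSet (mem_of_mem_faceSet hν (hl.1 x (by simp)).2.1 (hsupp y (hl.1 y hy))
          ((hsmall hl).2 x (by simp) y hy))
      refine exists_primitive_of_starConvex (p := Pi.single (ν x) 1)
        (Set.mem_biUnion (show x ∈ {y | y ∈ x :: l} by simp) (hp x (by simp))) ?_ hε hz hcyc
      exact starConvex_iUnion₂ fun y hy => (convex_faceSet _).starConvex (hp y hy)) n
  have hCs : ∀ l ∈ smallTuples Γ.realization δ,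
      smallTuples (C l) ε ⊆ smallTuples Γ.realization ε := fun l hl =>
    smallTuples_mono (Set.iUnion₂_subset fun x hx =>
      faceSet_subset_realization (hsupp' x (hl.1 x hx))) le_rfl
  have hz' : z ∈ Finsupp.supported K K (smallTuples Γ.realization δ ∩ {l | l.length = n}) := by
    rw [Finsupp.supported_inter]
    exact ⟨hz, hzn⟩
  refine ⟨h z + s u, Submodule.add_mem _ ?_ ?_, ?_⟩
  · refine map_mem_of_mem_supported ?_ hz'
    rintro l ⟨hl, hln⟩
    exact Finsupp.supported_mono (hCs l hl) (hh l hl (le_of_eq hln)).1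
  · refine map_mem_of_mem_supported ?_ hu
    intro σ hσ
    exact Finsupp.supported_mono (Set.inter_subset_left.trans
      (smallTuples_mono (faceSet_subset_realization hσ) le_rfl)) (hs σ)
  · have := map_eq_of_mem_supported (f := bdry K ∘ₗ h)
      (g := (LinearMap.id - s ∘ₗ orient K ν) - h ∘ₗ bdry K)
      (fun l hl => (hh l hl.1 (le_of_eq hl.2)).2) hz'
    simp only [LinearMap.comp_apply, LinearMap.sub_apply, LinearMap.id_apply, hcyc,
      map_zero, sub_zero] at this
    rw [map_add, this, hsb, hu', sub_add_cancel]

end Approximation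

end ASC

namespace ListChain

variable {K : Type*} [Field K]

lemma triv_univ_of_contractible {X : Type*} [PseudoMetricSpace X] [CompactSpace X]
    [ContractibleSpace X] (n : ℕ) : Triv K (Set.univ : Set X) n := by
  obtain ⟨p, ⟨F⟩⟩ := id_nullhomotopic X
  have hF := Metric.uniformContinuous_iff.1
    (CompactSpace.uniformContinuous_of_continuous F.continuous)
  intro ε hε
  obtain ⟨δ, hδ, h⟩ := hF ε hε
  obtain ⟨N, hN⟩ := exists_nat_one_div_lt hδ
  refine ⟨δ, hδ, fun z hz hcyc => ?_⟩
  have h01 : (0 : ℝ) ≤ 1 := zero_le_one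
  refine exists_primitive_of_contraction hε (T := smallTuples Set.univ δ) (N + 1)
    (fun k x => F (Set.projIcc 0 1 h01 ((k : ℝ) / (N + 1 : ℕ)), x)) p (Set.mem_univ p)
    ?_ ?_ ?_ ?_ hz.1 hcyc
  · intro l _ x _
    have : Set.projIcc 0 1 h01 (((0 : ℕ) : ℝ) / (N + 1 : ℕ)) = 0 := by simp
    simp only [this]
    simp
  · intro l _ x _
    have : Set.projIcc 0 1 h01 (((N + 1 : ℕ) : ℝ) / (N + 1 : ℕ)) = 1 := by
      rw [div_self (by positivity)]
      simp
    simp only [this]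
    simp
  · intros
    exact Set.mem_univ _
  · intro l hl x hx y hy i _ j _ hij hji
    refine h ?_
    rw [Prod.dist_eq, max_lt_iff]
    refine ⟨?_, hl.2 x hx y hy⟩
    rw [Subtype.dist_eq, Real.dist_eq]
    refine (Set.abs_projIcc_sub_projIcc h01).trans_lt (lt_of_le_of_lt ?_ hN)
    rw [← sub_div, abs_div, Nat.abs_cast, Nat.cast_add, Nat.cast_one]
    gcongr
    have h1 : (i : ℝ) ≤ j + 1 := by exact_mod_cast hij
    have h2 : (j : ℝ) ≤ i + 1 := by exact_mod_cast hji
    rw [abs_le]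
    constructor <;> linarith

lemma Triv.of_leftInverse {X Y : Type*} [PseudoMetricSpace X] [PseudoMetricSpace Y] [Nonempty X]
    [Nonempty Y] {S : Set X} {T : Set Y} [CompactSpace S] [CompactSpace T] {n : ℕ}
    (hT : Triv K T n) (f : C(S, T)) (g : C(T, S)) (hgf : ∀ x, g (f x) = x) : Triv K S n := by
  classical
  have hf : ∀ x (hx : x ∈ S),
      (if h : x ∈ S then (f ⟨x, h⟩ : Y) else Classical.arbitrary Y) = f ⟨x, hx⟩ :=
    fun x hx => dif_pos hx
  have hg : ∀ y (hy : y ∈ T),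
      (if h : y ∈ T then (g ⟨y, h⟩ : X) else Classical.arbitrary X) = g ⟨y, hy⟩ :=
    fun y hy => dif_pos hy
  refine hT.retract
    (f := fun x => if h : x ∈ S then (f ⟨x, h⟩ : Y) else Classical.arbitrary Y)
    (g := fun y => if h : y ∈ T then (g ⟨y, h⟩ : X) else Classical.arbitrary X) ?_ ?_ ?_ ?_ ?_
  · intro x hx
    simp only [hf x hx]
    exact (f _).2
  · intro y hy
    simp only [hg y hy]
    exact (g _).2
  · rw [uniformContinuousOn_iff_restrict]
    have : S.domRestrict (fun x => if h : x ∈ S then (f ⟨x, h⟩ : Y) else Classical.arbitrary Y) =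
        fun x => (f x : Y) := by
      funext x
      exact hf x.1 x.2
    rw [this]
    exact CompactSpace.uniformContinuous_of_continuous (by fun_prop)
  · rw [uniformContinuousOn_iff_restrict]
    have : T.domRestrict (fun y => if h : y ∈ T then (g ⟨y, h⟩ : X) else Classical.arbitrary X) =
        fun y => (g y : X) := by
      funext y
      exact hg y.1 y.2
    rw [this]
    exact CompactSpace.uniformContinuous_of_continuous (by fun_prop)
  · intro x hx
    simp only [hf x hx]
    rw [hg _ (f ⟨x, hx⟩).2]
    simp [hgf]

lemma triv_of_contractible {X : Type*} [PseudoMetricSpace X] {S : Set X} [CompactSpace S]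
    [ContractibleSpace S] (n : ℕ) : Triv K S n := by
  have hS : Nonempty S := inferInstance
  have : Nonempty X := hS.map Subtype.val
  have : CompactSpace (Set.univ : Set S) := isCompact_iff_compactSpace.1 isCompact_univ
  let e := (Homeomorph.Set.univ S).symm
  exact (triv_univ_of_contractible (K := K) (X := S) n).of_leftInverse (e : C(S, _))
    (e.symm : C(_, S)) (fun x => e.symm_apply_apply x)

lemma triv_iff_of_homeomorph {X Y : Type*} [PseudoMetricSpace X] [PseudoMetricSpace Y] [Nonempty X]
    [Nonempty Y] {S : Set X} {T : Set Y} [CompactSpace S] [CompactSpace T] (e : S ≃ₜ T) {n : ℕ} :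
    Triv K S n ↔ Triv K T n :=
  ⟨fun h => h.of_leftInverse (e.symm : C(T, S)) (e : C(S, T)) e.apply_symm_apply,
    fun h => h.of_leftInverse (e : C(S, T)) (e.symm : C(T, S)) e.symm_apply_apply⟩

end ListChain

lemma contractibleSpace_of_leftInverse {X Y : Type*} [TopologicalSpace X] [TopologicalSpace Y]
    [ContractibleSpace Y] (f : C(X, Y)) (g : C(Y, X)) (h : ∀ x, g (f x) = x) :
    ContractibleSpace X := by
  rw [contractible_iff_id_nullhomotopic]
  have := ((id_nullhomotopic Y).comp_right g).comp_left f
  convert this using 1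
  ext x
  simp [h]

lemma contractibleSpace_compl_singleton_sphere {E : Type*} [NormedAddCommGroup E]
    [InnerProductSpace ℝ E] (v : Metric.sphere (0 : E) 1) :
    ContractibleSpace ({v}ᶜ : Set (Metric.sphere (0 : E) 1)) := by
  have hv : ‖(v : E)‖ = 1 := by simp
  have e := (stereographic hv).toHomeomorphSourceTarget
  rw [stereographic_source, stereographic_target] at e
  exact (e.trans (Homeomorph.Set.univ _)).contractibleSpace

namespace ASC

variable {V : Type} [Fintype V]

lemma isCompact_faceSet (σ : Finset V) : IsCompact (faceSet σ) := by
  have : faceSet σ = stdSimplex ℝ V ∩ ⋂ v, {x : V → ℝ | v ∉ σ → x v = 0} := by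
    ext x
    simp only [faceSet, stdSimplex, Set.mem_ofPred_eq, Set.mem_inter_iff, Set.mem_iInter, and_assoc]
    refine and_congr_right fun _ => and_congr_right fun _ => forall_congr' fun v => ?_
    exact not_imp_comm
  rw [this]
  refine (isCompact_stdSimplex ℝ V).inter_right (isClosed_iInter fun v => ?_)
  by_cases hv : v ∈ σ
  · simp [hv]
  · simp only [hv, not_false_eq_true, true_imp_iff]
    exact isClosed_eq (continuous_apply v) continuous_const

instance compactSpace_realization (Γ : ASC V) : CompactSpace Γ.realization := by
  rw [← isCompact_iff_compactSpace]
  have : Γ.realization = ⋃ σ ∈ Γ.faces, faceSet σ := by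
    ext x
    simp [mem_realization_iff]
  rw [this]
  exact (Set.toFinite _).isCompact_biUnion fun σ _ => isCompact_faceSet σ

/-- The subcomplex of all faces not containing `τ`. -/
def deletion {V : Type} (Γ : ASC V) (τ : Finset V) : ASC V where
  faces := {ρ | ρ ∈ Γ.faces ∧ ¬ τ ⊆ ρ}
  down_closed := fun _ _ h hsub => ⟨Γ.down_closed h.1 hsub, fun h' => h.2 (h'.trans hsub)⟩

lemma realization_deletion_subset (Γ : ASC V) (τ : Finset V) :
    (Γ.deletion τ).realization ⊆ Γ.realization :=
  fun _ ⟨h0, h1, σ, hσ, h⟩ => ⟨h0, h1, σ, hσ.1, h⟩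

section Deletion

variable {τ : Finset V} (hτ : τ.Nonempty)

/-- The smallest of the weights of the vertices in `τ`. -/
noncomputable def minWeight (x : V → ℝ) : ℝ := τ.inf' hτ x

open Classical in
/-- The radial projection away from the barycenter of `τ`. -/
noncomputable def radial (x : V → ℝ) (v : V) : ℝ :=
  (x v - if v ∈ τ then minWeight hτ x else 0) / (1 - τ.card * minWeight hτ x)

open Classical in
/-- The barycenter of `τ`. -/
noncomputable def barycenter (τ : Finset V) (v : V) : ℝ := if v ∈ τ then (τ.card : ℝ)⁻¹ else 0

lemma barycenter_mem (hτ : τ.Nonempty) {Γ : ASC V} (h : τ ∈ Γ.faces) :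
    barycenter τ ∈ Γ.realization := by
  have hc : (τ.card : ℝ) ≠ 0 := by exact_mod_cast hτ.card_pos.ne'
  refine ⟨fun v => ?_, ?_, τ, h, fun v => ?_⟩
  · unfold barycenter
    positivity
  · simp [barycenter, Finset.sum_ite_mem, hc]
  · simp only [barycenter]
    split_ifs with h <;> simp [h, hτ.ne_empty]

lemma barycenter_notMem_deletion (hτ : τ.Nonempty) (Γ : ASC V) :
    barycenter τ ∉ (Γ.deletion τ).realization := by
  have hc : (τ.card : ℝ) ≠ 0 := by exact_mod_cast hτ.card_pos.ne'
  rintro ⟨-, -, σ, hσ, h⟩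
  refine hσ.2 fun v hv => (h v).1 ?_
  simp [barycenter, hv, hτ.ne_empty]

lemma card_mul_minWeight_lt {Γ : ASC V} {x : V → ℝ} (hx : x ∈ Γ.realization)
    (hb : x ≠ barycenter τ) : τ.card * minWeight hτ x < 1 := by
  classical
  have hc : (0 : ℝ) < τ.card := by exact_mod_cast hτ.card_pos
  have hle : ∀ v ∈ τ, minWeight hτ x ≤ x v := fun v hv => Finset.inf'_le _ hv
  have h1 : τ.card * minWeight hτ x ≤ ∑ v ∈ τ, x v := by
    rw [← nsmul_eq_mul]
    exact Finset.card_nsmul_le_sum _ _ _ hle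
  have h2 : ∑ v ∈ τ, x v ≤ 1 := by
    rw [← hx.2.1]
    exact Finset.sum_le_sum_of_subset_of_nonneg (Finset.subset_univ _) fun v _ _ => hx.1 v
  refine (h1.trans h2).lt_of_ne fun heq => hb ?_
  have h3 : ∑ v ∈ τ, x v = 1 := by linarith
  have hm : minWeight hτ x = (τ.card : ℝ)⁻¹ := eq_inv_of_mul_eq_one_right heq
  funext v
  by_cases hv : v ∈ τ
  · have h4 : ∑ v ∈ τ, minWeight hτ x = ∑ v ∈ τ, x v := by
      rw [Finset.sum_const, nsmul_eq_mul, h3, heq]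
    have := (Finset.sum_eq_sum_iff_of_le hle).1 h4 v hv
    simp [barycenter, hv, ← this, hm]
  · have h5 : ∑ v ∈ τᶜ, x v = 0 := by
      have := Finset.sum_add_sum_compl τ x
      rw [hx.2.1] at this
      linarith
    have := (Finset.sum_eq_zero_iff_of_nonneg fun v _ => hx.1 v).1 h5 v (by simpa using hv)
    simp [barycenter, hv, this]

lemma radial_mem {Γ : ASC V} {x : V → ℝ} (hx : x ∈ Γ.realization) (hb : x ≠ barycenter τ) :
    radial hτ x ∈ (Γ.deletion τ).realization := by
  classical
  have hlt := card_mul_minWeight_lt hτ hx hb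
  have hpos : 0 < 1 - τ.card * minWeight hτ x := by linarith
  have hle : ∀ v ∈ τ, minWeight hτ x ≤ x v := fun v hv => Finset.inf'_le _ hv
  have hm0 : 0 ≤ minWeight hτ x := (Finset.le_inf'_iff hτ _).2 fun v _ => hx.1 v
  have hnum : ∀ v, 0 ≤ x v - if v ∈ τ then minWeight hτ x else 0 := by
    intro v
    split_ifs with h
    · linarith [hle v h]
    · simpa using hx.1 v
  refine ⟨fun v => div_nonneg (hnum v) hpos.le, ?_,
    univ.filter fun v => radial hτ x v ≠ 0, ⟨?_, ?_⟩, by simp⟩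
  · simp only [radial]
    rw [← Finset.sum_div, Finset.sum_sub_distrib, hx.2.1, Finset.sum_ite_mem, Finset.univ_inter,
      Finset.sum_const, nsmul_eq_mul, div_self hpos.ne']
  · obtain ⟨-, -, σ, hσ, h⟩ := hx
    refine Γ.down_closed hσ fun v hv => (h v).1 fun h0 => ?_
    refine (Finset.mem_filter.1 hv).2 ?_
    have := hnum v
    rw [h0] at this
    simp only [radial, h0]
    split_ifs at this ⊢ with hv
    · rw [le_antisymm (by linarith : minWeight hτ x ≤ 0) hm0]
      simp
    · simp
  · obtain ⟨v, hv, hv'⟩ := Finset.exists_mem_eq_inf' hτ x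
    intro hsub
    refine (Finset.mem_filter.1 (hsub hv)).2 ?_
    simp [radial, hv, minWeight, hv']

lemma radial_eq_self {Γ : ASC V} {x : V → ℝ} (hx : x ∈ (Γ.deletion τ).realization) :
    radial hτ x = x := by
  classical
  have : minWeight hτ x = 0 := by
    refine le_antisymm ?_ ((Finset.le_inf'_iff hτ _).2 fun v _ => hx.1 v)
    obtain ⟨-, -, σ, hσ, h⟩ := hx
    obtain ⟨v, hv, hv'⟩ := Finset.not_subset.1 hσ.2
    rw [← not_not.1 (mt (h v).1 hv')]
    exact Finset.inf'_le _ hv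
  funext v
  simp [radial, this]

lemma continuousOn_radial (Γ : ASC V) :
    ContinuousOn (radial hτ) (Γ.realization \ {barycenter τ}) := by
  have : Continuous (minWeight hτ) := Continuous.finset_inf'_apply hτ fun v _ => continuous_apply v
  refine continuousOn_pi.2 fun v => ContinuousOn.div ?_ ?_ fun x hx => ?_
  · refine Continuous.continuousOn ((continuous_apply v).sub ?_)
    split_ifs <;> fun_prop
  · fun_prop
  · have := card_mul_minWeight_lt hτ hx.1 hx.2
    linarith

end Deletion

/-- Deleting the open star of a face from a triangulated sphere leaves a contractible space. -/
lemma contractibleSpace_deletion {τ : Finset V} (hτ : τ.Nonempty)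
    {E : Type*} [NormedAddCommGroup E] [InnerProductSpace ℝ E]
    {Γ : ASC V} (h : τ ∈ Γ.faces) (e : Γ.realization ≃ₜ Metric.sphere (0 : E) 1) :
    ContractibleSpace (Γ.deletion τ).realization := by
  let b : Γ.realization := ⟨barycenter τ, barycenter_mem hτ h⟩
  have := contractibleSpace_compl_singleton_sphere (e b)
  refine contractibleSpace_of_leftInverse (Y := ({e b}ᶜ : Set (Metric.sphere (0 : E) 1)))
    ⟨fun x => ⟨e ⟨x.1, realization_deletion_subset Γ τ x.2⟩, fun hx => ?_⟩, ?_⟩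
    ⟨fun y => ⟨radial hτ (e.symm y.1), radial_mem hτ (e.symm y.1).2 fun hy => ?_⟩, ?_⟩ ?_
  · have h1 : (⟨x.1, realization_deletion_subset Γ τ x.2⟩ : Γ.realization) = b := e.injective hx
    have h2 : x.1 = barycenter τ := congrArg Subtype.val h1
    exact barycenter_notMem_deletion hτ Γ (h2 ▸ x.2)
  · fun_prop
  · refine y.2 ?_
    have : e.symm y.1 = b := Subtype.ext hy
    exact (e.apply_symm_apply _).symm.trans (congrArg e this)
  · refine Continuous.subtype_mk ?_ _
    refine (continuousOn_radial hτ Γ).comp_continuous (by fun_prop) fun y =>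
      ⟨(e.symm y.1).2, fun hy => y.2 ?_⟩
    have : e.symm y.1 = b := Subtype.ext hy
    exact (e.apply_symm_apply _).symm.trans (congrArg e this)
  · intro x
    apply Subtype.ext
    simp [radial_eq_self hτ x.2]

end ASC

/-- The boundary complex of the `d`-dimensional cross-polytope. -/
def octahedron (d : ℕ) : ASC (Fin d ×ₗ Bool) where
  faces := {σ | ∀ i, toLex (i, true) ∈ σ → toLex (i, false) ∉ σ}
  down_closed := fun _ _ h hsub i hi hi' => h i (hsub hi) (hsub hi')

namespace octahedron

variable {d : ℕ}

lemma sum_eq (x : Fin d ×ₗ Bool → ℝ) :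
    ∑ v, x v = ∑ i, (x (toLex (i, true)) + x (toLex (i, false))) := by
  rw [← Fintype.sum_equiv (toLex : Fin d × Bool ≃ Fin d ×ₗ Bool) (fun v => x (toLex v)) x
    fun _ => rfl, Fintype.sum_prod_type]
  simp

/-- The facet of all positive vertices. -/
def positiveFacet (d : ℕ) : Finset (Fin d ×ₗ Bool) := univ.image fun i => toLex (i, true)

lemma card_positiveFacet (d : ℕ) : (positiveFacet d).card = d := by
  rw [positiveFacet, Finset.card_image_of_injective _ fun _ _ h =>
    (Prod.ext_iff.1 (toLex_inj.1 h)).1, Finset.card_univ, Fintype.card_fin]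

lemma isMaximalFace (d : ℕ) : (octahedron d).IsMaximalFace (positiveFacet d) := by
  refine ⟨fun i _ => by simp [positiveFacet], fun τ hτ hsub =>
    subset_antisymm (fun v hv => ?_) hsub⟩
  obtain ⟨⟨i, b⟩, rfl⟩ := toLex.surjective v
  cases b
  · exact absurd hv (hτ i (hsub (by simp [positiveFacet])))
  · simp [positiveFacet]

/-- The differences of the weights of opposite vertices. -/
noncomputable def diff (x : Fin d ×ₗ Bool → ℝ) : EuclideanSpace ℝ (Fin d) :=
  WithLp.toLp 2 fun i => x (toLex (i, true)) - x (toLex (i, false))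

/-- The normalized positive and negative parts of the coordinates of a vector. -/
noncomputable def parts (y : EuclideanSpace ℝ (Fin d)) (v : Fin d ×ₗ Bool) : ℝ :=
  max (if (ofLex v).2 then y (ofLex v).1 else -y (ofLex v).1) 0 / ∑ i, |y i|

lemma eq_zero_or {x : Fin d ×ₗ Bool → ℝ} (hx : x ∈ (octahedron d).realization) (i : Fin d) :
    x (toLex (i, true)) = 0 ∨ x (toLex (i, false)) = 0 := by
  obtain ⟨-, -, σ, hσ, h⟩ := hx
  by_contra! hne
  exact hσ i ((h _).1 hne.1) ((h _).1 hne.2)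

lemma max_diff {x : Fin d ×ₗ Bool → ℝ} (hx : x ∈ (octahedron d).realization) (i : Fin d) :
    max (diff x i) 0 = x (toLex (i, true)) ∧ max (-diff x i) 0 = x (toLex (i, false)) ∧
      |diff x i| = x (toLex (i, true)) + x (toLex (i, false)) := by
  have h1 := hx.1 (toLex (i, true))
  have h2 := hx.1 (toLex (i, false))
  rcases eq_zero_or hx i with h | h <;> simp [diff, h, h1, h2]

lemma sum_abs_diff {x : Fin d ×ₗ Bool → ℝ} (hx : x ∈ (octahedron d).realization) :
    ∑ i, |diff x i| = 1 := by
  rw [← hx.2.1, sum_eq]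
  exact Finset.sum_congr rfl fun i _ => (max_diff hx i).2.2

lemma diff_ne_zero {x : Fin d ×ₗ Bool → ℝ} (hx : x ∈ (octahedron d).realization) :
    diff x ≠ 0 := by
  intro h
  have := sum_abs_diff hx
  simp [h] at this

lemma sum_abs_pos {y : EuclideanSpace ℝ (Fin d)} (hy : y ≠ 0) : 0 < ∑ i, |y i| := by
  refine lt_of_le_of_ne (Finset.sum_nonneg fun _ _ => abs_nonneg _) fun h => hy ?_
  ext i
  exact abs_eq_zero.1 ((Finset.sum_eq_zero_iff_of_nonneg fun _ _ => abs_nonneg _).1 h.symm i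
    (mem_univ i))

lemma parts_mem {y : EuclideanSpace ℝ (Fin d)} (hy : y ≠ 0) :
    parts y ∈ (octahedron d).realization := by
  have hpos := sum_abs_pos hy
  refine ⟨fun v => div_nonneg (le_max_right _ _) hpos.le, ?_,
    univ.filter fun v => parts y v ≠ 0, fun i hi hi' => ?_, by simp⟩
  · rw [sum_eq, ← div_self hpos.ne', Finset.sum_div]
    refine Finset.sum_congr rfl fun i _ => ?_
    simp only [parts, ofLex_toLex, if_true, Bool.false_eq_true, if_false]
    rw [← add_div]
    congr 1
    rcases le_total 0 (y i) with h | h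
    · simp [h, abs_of_nonneg]
    · simp [h, abs_of_nonpos]
  · simp only [parts, mem_filter, ofLex_toLex, if_true, Bool.false_eq_true, if_false, mem_univ,
      true_and] at hi hi'
    rcases le_total 0 (y i) with h | h
    · simp [h] at hi'
    · simp [h] at hi

lemma diff_parts (y : EuclideanSpace ℝ (Fin d)) :
    diff (parts y) = (∑ i, |y i|)⁻¹ • y := by
  ext i
  simp only [diff, parts, ofLex_toLex, if_true, Bool.false_eq_true, if_false, PiLp.smul_apply,
    smul_eq_mul]
  rw [← sub_div, div_eq_inv_mul]
  congr 1
  rcases le_total 0 (y i) with h | h <;> simp [h]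

lemma parts_smul_diff {x : Fin d ×ₗ Bool → ℝ} (hx : x ∈ (octahedron d).realization) {c : ℝ}
    (hc : 0 < c) : parts (c • diff x) = x := by
  funext v
  obtain ⟨⟨i, b⟩, rfl⟩ := toLex.surjective v
  have h1 : ∑ i, |(c • diff x) i| = c := by
    simp only [PiLp.smul_apply, smul_eq_mul, abs_mul, abs_of_pos hc, ← Finset.mul_sum,
      sum_abs_diff hx, mul_one]
  have h2 : ∀ t : ℝ, max (c * t) 0 = c * max t 0 := fun t => by
    rw [mul_max_of_nonneg _ _ hc.le, mul_zero]
  rw [parts, h1, div_eq_iff hc.ne', mul_comm (x _)]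
  cases b
  · rw [← (max_diff hx i).2.1, ← h2, mul_neg]
    simp
  · rw [← (max_diff hx i).1, ← h2]
    simp

/-- The octahedral complex triangulates the sphere. -/
noncomputable def homeomorph (d : ℕ) :
    (octahedron d).realization ≃ₜ Metric.sphere (0 : EuclideanSpace ℝ (Fin d)) 1 where
  toFun x := ⟨‖diff x.1‖⁻¹ • diff x.1, by
    rw [mem_sphere_zero_iff_norm, norm_smul, norm_inv, norm_norm,
      inv_mul_cancel₀ (norm_ne_zero_iff.2 (diff_ne_zero x.2))]⟩
  invFun y := ⟨parts y.1, parts_mem (ne_zero_of_mem_unit_sphere y)⟩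
  left_inv x := Subtype.ext (parts_smul_diff x.2 (by
    have := norm_pos_iff.2 (diff_ne_zero x.2)
    positivity))
  right_inv y := by
    have hpos := sum_abs_pos (ne_zero_of_mem_unit_sphere y)
    have hy : ‖(y : EuclideanSpace ℝ (Fin d))‖ = 1 := by simp
    apply Subtype.ext
    simp only [diff_parts, norm_smul, hy, norm_inv, Real.norm_eq_abs, abs_of_pos hpos, mul_one,
      inv_inv]
    rw [smul_smul, mul_inv_cancel₀ hpos.ne', one_smul]
  continuous_toFun := by
    have h : Continuous fun x : (octahedron d).realization => diff x.1 := by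
      refine (PiLp.continuous_toLp 2 _).comp (continuous_pi fun i => ?_)
      exact ((continuous_apply _).comp continuous_subtype_val).sub
        ((continuous_apply _).comp continuous_subtype_val)
    exact ((h.norm.inv₀ fun x => norm_ne_zero_iff.2 (diff_ne_zero x.2)).smul h).subtype_mk _
  continuous_invFun := by
    refine Continuous.subtype_mk (continuous_pi fun v => ?_) _
    refine Continuous.div ?_ (by fun_prop) fun y =>
      (sum_abs_pos (ne_zero_of_mem_unit_sphere y)).ne'
    split_ifs <;> fun_prop

end octahedron

namespace ASC

open FaceChain ListChain

variable {V : Type}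

lemma mem_supported_deletion {K : Type*} [Field K] {Γ : ASC V} {σ : Finset V}
    {S : Set (Finset V)} (hσ : Γ.IsMaximalFace σ) {z : Finset V →₀ K}
    (hz : z ∈ Finsupp.supported K K (Γ.faces ∩ S)) (h : z σ = 0) :
    z ∈ Finsupp.supported K K ((Γ.deletion σ).faces ∩ S) := by
  rw [Finsupp.mem_supported] at hz ⊢
  intro ρ hρ
  refine ⟨⟨(hz hρ).1, fun hsub => ?_⟩, (hz hρ).2⟩
  rw [hσ.2 ρ (hz hρ).1 hsub] at hρ
  simp [h] at hρ

lemma deletion_faces_subset (Γ : ASC V) (σ : Finset V) : (Γ.deletion σ).faces ⊆ Γ.faces :=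
  fun _ h => h.1

lemma bd_apply_eq_zero [LinearOrder V] {K : Type*} [Field K] {Γ : ASC V} {σ : Finset V}
    (hσ : Γ.IsMaximalFace σ) {w : Finset V →₀ K}
    (hw : w ∈ Finsupp.supported K K Γ.faces) : bd K w σ = 0 := by
  refine map_eq_of_mem_supported (f := Finsupp.lapply σ ∘ₗ bd K) (g := 0) (fun ρ hρ => ?_) hw
  rw [LinearMap.comp_apply, bd_single, map_sum, LinearMap.zero_apply]
  refine Finset.sum_eq_zero fun v hv => ?_
  rw [Finsupp.lapply_apply, Finsupp.single_apply, if_neg]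
  intro h
  have h1 := hσ.2 ρ hρ (h ▸ Finset.erase_subset v ρ)
  rw [← h] at h1
  exact Finset.notMem_erase v ρ (h1 ▸ hv)

lemma exists_isMaximalFace [Finite V] {Γ : ASC V} {σ : Finset V}
    (hσ : σ ∈ Γ.faces) :
    ∃ τ, Γ.IsMaximalFace τ ∧ σ ⊆ τ := by
  obtain ⟨τ, hle, hτ⟩ := (Set.toFinite Γ.faces).exists_le_maximal hσ
  exact ⟨τ, ⟨hτ.prop, fun τ' h' h => subset_antisymm (hτ.le_of_ge h' h) h⟩, hle⟩

section Facet

variable [LinearOrder V] {K : Type*} [Field K] {Γ : ASC V} {σ : Finset V}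

lemma acyclicAt_of_ne_card (hσ : Γ.IsMaximalFace σ) {k : ℕ} (hk : k ≠ σ.card)
    (hA : AcyclicAt K (Γ.deletion σ) k) : AcyclicAt K Γ k := by
  intro z hz hcyc
  have h0 : z σ = 0 := by
    by_contra h0
    exact hk ((Finsupp.mem_supported _ _).1 hz (Finsupp.mem_support_iff.2 h0)).2.symm
  obtain ⟨w, hw, h⟩ := hA z (mem_supported_deletion hσ hz h0) hcyc
  exact ⟨w, Finsupp.supported_mono (deletion_faces_subset Γ σ) hw, h⟩

lemma exists_cycle (hσ : Γ.IsMaximalFace σ)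
    (hA : AcyclicAt K (Γ.deletion σ) (σ.card - 1)) (hne : σ.Nonempty) :
    ∃ z ∈ Finsupp.supported K K (Γ.faces ∩ {ρ | ρ.card = σ.card}), bd K z = 0 ∧ z σ = 1 := by
  have hc := hne.card_pos
  have hmem : bd K (Finsupp.single σ 1) ∈
      Finsupp.supported K K ((Γ.deletion σ).faces ∩ {ρ | ρ.card = σ.card - 1}) := by
    refine Finsupp.supported_mono (fun ρ hρ => ?_) (bd_single_mem σ)
    have hlt : ρ.card + 1 = σ.card := hρ.2
    refine ⟨⟨Γ.down_closed hσ.1 hρ.1, fun hsub => ?_⟩, ?_⟩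
    · have := Finset.card_le_card hsub
      omega
    · simp only [Set.mem_ofPred_eq]
      omega
  obtain ⟨w, hw, h⟩ := hA _ hmem (bd_bd _)
  obtain ⟨y, hy, h⟩ := exists_homogeneous_primitive Finset.card (bd K)
    (fun ρ => Finsupp.supported_mono (fun _ h => h.2) (bd_single_mem ρ))
    (Finsupp.supported_mono (fun _ h => h.2) hmem) hw h
  rw [show σ.card - 1 + 1 = σ.card by omega] at hy
  refine ⟨Finsupp.single σ 1 - y, Submodule.sub_mem _
    (Finsupp.single_mem_supported K 1 (Set.mem_inter hσ.1 rfl))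
    (Finsupp.supported_mono (Set.inter_subset_inter_left _ (deletion_faces_subset Γ σ)) hy), ?_, ?_⟩
  · rw [map_sub, h, sub_self]
  · have : y σ = 0 := by
      by_contra h0
      exact ((Finsupp.mem_supported _ _).1 hy (Finsupp.mem_support_iff.2 h0)).1.2 subset_rfl
    simp [this]

lemma acyclicAt_iff_ne_card (hσ : Γ.IsMaximalFace σ) (hne : σ.Nonempty)
    (hA : ∀ k, AcyclicAt K (Γ.deletion σ) k) {k : ℕ} : AcyclicAt K Γ k ↔ k ≠ σ.card := by
  refine ⟨?_, fun h => acyclicAt_of_ne_card hσ h (hA k)⟩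
  rintro h rfl
  obtain ⟨z, hz, hcyc, h1⟩ := exists_cycle hσ (hA _) hne
  obtain ⟨w, hw, rfl⟩ := h z hz hcyc
  rw [bd_apply_eq_zero hσ hw] at h1
  exact zero_ne_one h1

variable (K) in
/-- The combinatorial properties of a triangulated sphere of dimension `d - 1` which imply duality
for its induced subcomplexes. -/
structure IsSphere (Γ : ASC V) (d : ℕ) : Prop where
  empty_mem : ∅ ∈ Γ.faces
  card_le : ∀ σ ∈ Γ.faces, σ.card ≤ d
  acyclicAt : ∀ k < d, AcyclicAt K Γ k
  exists_fundamentalCycle : ∃ z ∈ Finsupp.supported K K (Γ.faces ∩ {ρ | ρ.card = d}),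
    bd K z = 0 ∧ z ≠ 0 ∧
      ∀ z' ∈ Finsupp.supported K K (Γ.faces ∩ {ρ | ρ.card = d}), bd K z' = 0 → ∃ a : K, z' = a • z
  acyclicAt_deletion : ∀ τ ∈ Γ.faces, τ.Nonempty → ∀ k, AcyclicAt K (Γ.deletion τ) k

variable [Fintype V]

lemma isSphere_of_acyclicAt_deletion (h0 : ∅ ∈ Γ.faces) (hσ : Γ.IsMaximalFace σ)
    (hne : σ.Nonempty)
    (hA : ∀ τ ∈ Γ.faces, τ.Nonempty → ∀ k, AcyclicAt K (Γ.deletion τ) k) :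
    IsSphere K Γ σ.card := by
  have hσA := hA σ hσ.1 hne
  have hiff := fun k => acyclicAt_iff_ne_card (k := k) hσ hne hσA
  have hle : ∀ ρ ∈ Γ.faces, ρ.card ≤ σ.card := by
    intro ρ hρ
    obtain ⟨τ, hτ, hsub⟩ := exists_isMaximalFace hρ
    refine (Finset.card_le_card hsub).trans ?_
    rcases τ.eq_empty_or_nonempty with rfl | hτne
    · simp
    · have h1 := hiff τ.card
      rw [acyclicAt_iff_ne_card hτ hτne (hA τ hτ.1 hτne)] at h1
      by_contra h
      exact h1.2 (by omega) rfl
  refine ⟨h0, hle, fun k hk => (hiff k).2 hk.ne, ?_, hA⟩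
  obtain ⟨z, hz, hcyc, h1⟩ := exists_cycle hσ (hσA _) hne
  refine ⟨z, hz, hcyc, fun h => by simp [h] at h1, fun z' hz' hcyc' => ⟨z' σ, ?_⟩⟩
  have hmem : z' - z' σ • z ∈ Finsupp.supported K K (Γ.faces ∩ {ρ | ρ.card = σ.card}) :=
    Submodule.sub_mem _ hz' (Submodule.smul_mem _ _ hz)
  obtain ⟨w, hw, h⟩ := hσA _ _ (mem_supported_deletion hσ hmem (by simp [h1]))
    (by simp [hcyc, hcyc'])
  obtain ⟨y, hy, h⟩ := exists_homogeneous_primitive Finset.card (bd K)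
    (fun ρ => Finsupp.supported_mono (fun _ h => h.2) (bd_single_mem ρ))
    (Finsupp.supported_mono (fun _ h => h.2) hmem) hw h
  have hy0 : y = 0 := by
    rw [← Finsupp.support_eq_empty, Finset.eq_empty_iff_forall_notMem]
    intro ρ hρ
    obtain ⟨h2, h3⟩ := (Finsupp.mem_supported _ _).1 hy hρ
    have := hle ρ h2.1
    simp only [Set.mem_ofPred_eq] at h3
    omega
  rw [hy0, map_zero] at h
  exact sub_eq_zero.1 h.symm

variable (K) in
lemma acyclicAt_deletion_of_homeomorph {E : Type*} [NormedAddCommGroup E] [InnerProductSpace ℝ E]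
    (e : Γ.realization ≃ₜ Metric.sphere (0 : E) 1) {τ : Finset V} (hτ : τ ∈ Γ.faces)
    (hne : τ.Nonempty) (k : ℕ) : AcyclicAt K (Γ.deletion τ) k := by
  have := contractibleSpace_deletion hne hτ e
  have : Nonempty V := ⟨hne.choose⟩
  refine acyclicAt_of_triv (Γ := Γ.deletion τ)
    ⟨Γ.down_closed hτ (Finset.empty_subset _), fun h => ?_⟩
    (triv_of_contractible k)
  exact hne.ne_empty (Finset.subset_empty.1 h)

variable (K) in
lemma isSphere_of_homeomorph {d : ℕ} (hd : 0 < d)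
    (e : Γ.realization ≃ₜ Metric.sphere (0 : EuclideanSpace ℝ (Fin d)) 1) : IsSphere K Γ d := by
  have : Nonempty (Fin d) := ⟨⟨0, hd⟩⟩
  have : Nonempty (Fin d ×ₗ Bool) := ⟨toLex (⟨0, hd⟩, true)⟩
  obtain ⟨y⟩ : Nonempty (Metric.sphere (0 : EuclideanSpace ℝ (Fin d)) 1) :=
    (NormedSpace.sphere_nonempty.2 zero_le_one).to_subtype
  obtain ⟨hx0, hx1, ρ, hρ, hx⟩ := (e.symm y).2
  have hρne : ρ.Nonempty := by
    rw [Finset.nonempty_iff_ne_empty]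
    rintro rfl
    have : ∀ v, (e.symm y : V → ℝ) v = 0 := fun v => by
      by_contra h
      simpa using (hx v).1 h
    simp [this] at hx1
  have : Nonempty V := ⟨hρne.choose⟩
  obtain ⟨σ, hσ, hsub⟩ := exists_isMaximalFace hρ
  have hσne := hρne.mono hsub
  have hΓ := isSphere_of_acyclicAt_deletion (K := K) (Γ.down_closed hρ (Finset.empty_subset _)) hσ
    hσne fun τ hτ hτne => acyclicAt_deletion_of_homeomorph K e hτ hτne
  suffices σ.card = d from this ▸ hΓ
  have h1 := acyclicAt_iff_ne_card (k := d) hσ hσne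
    (acyclicAt_deletion_of_homeomorph K e hσ.1 hσne)
  have hO := octahedron.isMaximalFace d
  have hOne : (octahedron.positiveFacet d).Nonempty := univ_nonempty.image _
  have h2 := acyclicAt_iff_ne_card (k := d) hO hOne
    (acyclicAt_deletion_of_homeomorph K (octahedron.homeomorph d) hO.1 hOne)
  rw [octahedron.card_positiveFacet] at h2
  have h3 : AcyclicAt K Γ d ↔ AcyclicAt K (octahedron d) d := by
    have h4 := triv_iff_of_homeomorph (K := K) (e.trans (octahedron.homeomorph d).symm) (n := d)
    have h5 : ∅ ∈ (octahedron d).faces := (octahedron d).down_closed hO.1 (Finset.empty_subset _)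
    exact ⟨fun h => acyclicAt_of_triv h5 (h4.1 (triv_of_acyclicAt hΓ.empty_mem h)),
      fun h => acyclicAt_of_triv hΓ.empty_mem (h4.2 (triv_of_acyclicAt h5 h))⟩
  by_contra hcon
  exact h2.1 (h3.1 (h1.2 (Ne.symm hcon))) rfl

end Facet

end ASC

namespace FaceChain

open ListChain

variable {V : Type*} (K : Type*) [Field K]

/-- The chains spanned by the sets not containing `τ`. -/
noncomputable abbrev Avoiding (τ : Finset V) : Submodule K (Finset V →₀ K) :=
  Finsupp.supported K K {ρ | ¬ τ ⊆ ρ}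

variable {K} in
lemma avoiding_mono {σ τ : Finset V} (h : σ ⊆ τ) : Avoiding K σ ≤ Avoiding K τ :=
  Finsupp.supported_mono fun _ hρ h' => hρ (h.trans h')

variable {K} in
lemma eq_zero_of_avoiding_empty {a : Finset V →₀ K} (ha : a ∈ Avoiding K (∅ : Finset V)) :
    a = 0 := by
  rw [← Finsupp.support_eq_empty, Finset.eq_empty_iff_forall_notMem]
  intro ρ hρ
  exact (Finsupp.mem_supported _ _).1 ha hρ (Finset.empty_subset ρ)

variable [LinearOrder V]

/-- The slice of a chain along `τ`: the part consisting of the faces meeting `I` exactly in `τ`,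
with `τ` removed. -/
noncomputable def slice (I τ : Finset V) : (Finset V →₀ K) →ₗ[K] (Finset V →₀ K) :=
  Finsupp.linearCombination K fun ρ =>
    if ρ ∩ I = τ then Finsupp.single (ρ \ τ) (∏ t ∈ τ, sg K t (ρ \ τ)) else 0

variable {K} {I : Finset V}

lemma slice_of_eq {τ ρ : Finset V} (h : ρ ∩ I = τ) : slice K I τ (Finsupp.single ρ 1) =
    Finsupp.single (ρ \ τ) (∏ t ∈ τ, sg K t (ρ \ τ)) := by
  simp [slice, h]

lemma slice_of_ne {τ ρ : Finset V} (h : ρ ∩ I ≠ τ) : slice K I τ (Finsupp.single ρ 1) = 0 := by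
  simp [slice, h]

lemma sg_union {v : V} {σ τ : Finset V} (h : Disjoint σ τ) :
    sg K v (σ ∪ τ) = sg K v σ * sg K v τ :=
  Finset.prod_union h

lemma sg_mul_prod_sg_erase {τ κ : Finset V} (h : Disjoint τ κ) {v : V} (hv : v ∈ κ) :
    sg K v τ * ∏ t ∈ τ, sg K t (κ.erase v) = (-1) ^ τ.card * ∏ t ∈ τ, sg K t κ := by
  rw [sg, ← Finset.prod_const, ← Finset.prod_mul_distrib, ← Finset.prod_mul_distrib]
  refine Finset.prod_congr rfl fun t ht => ?_
  have hne : v ≠ t := fun e => Finset.disjoint_left.1 h ht (e ▸ hv)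
  nth_rewrite 2 [← Finset.insert_erase hv]
  rw [sg_insert (Finset.notMem_erase v κ), ← transpSign_mul hne, ← mul_assoc,
    mul_assoc (transpSign K t v), transpSign_mul_self, mul_one]

lemma slice_bd_single [Fintype V] (τ ρ : Finset V) :
    slice K I τ (bd K (Finsupp.single ρ 1)) =
      (∑ w ∈ τᶜ, sg K w τ • slice K I (insert w τ) (Finsupp.single ρ 1)) +
        (-1 : K) ^ τ.card • bd K (slice K I τ (Finsupp.single ρ 1)) := by
  have hL : slice K I τ (bd K (Finsupp.single ρ 1)) =
      ∑ v ∈ ρ, sg K v ρ • slice K I τ (Finsupp.single (ρ.erase v) 1) := by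
    rw [bd_single, map_sum]
    refine Finset.sum_congr rfl fun v _ => ?_
    rw [← map_smul, Finsupp.smul_single, smul_eq_mul, mul_one]
  have hinter : ∀ v, ρ.erase v ∩ I = (ρ ∩ I).erase v := fun v => by
    rw [Finset.erase_inter]
  rw [hL]
  by_cases h : ρ ∩ I = τ
  · have hτρ : τ ⊆ ρ := h ▸ Finset.inter_subset_left
    rw [slice_of_eq h, Finset.sum_eq_zero (s := τᶜ), zero_add]
    · have h1 : Finsupp.single (ρ \ τ) (∏ t ∈ τ, sg K t (ρ \ τ)) =
          (∏ t ∈ τ, sg K t (ρ \ τ)) • Finsupp.single (ρ \ τ) (1 : K) := by simp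
      rw [h1, map_smul, bd_single, Finset.smul_sum, Finset.smul_sum]
      symm
      refine Finset.sum_subset_zero_on_sdiff Finset.sdiff_subset (fun v hv => ?_) fun v hv => ?_
      · have hvτ : v ∈ τ := by
          by_contra hc
          simp only [mem_sdiff, not_and, not_not] at hv
          exact hc (hv.2 hv.1)
        rw [slice_of_ne, smul_zero]
        rw [hinter, h]
        exact fun e => Finset.notMem_erase v τ (e.symm ▸ hvτ)
      · obtain ⟨hvρ, hvτ⟩ := Finset.mem_sdiff.1 hv
        rw [slice_of_eq (by rw [hinter, h, Finset.erase_eq_of_notMem hvτ]),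
          Finset.erase_sdiff_comm]
        simp only [Finsupp.smul_single, smul_eq_mul]
        congr 1
        have h2 : sg K v ρ = sg K v τ * sg K v (ρ \ τ) := by
          rw [← sg_union Finset.disjoint_sdiff, Finset.union_sdiff_of_subset hτρ]
        rw [h2, ← mul_assoc, ← sg_mul_prod_sg_erase Finset.disjoint_sdiff hv]
        ring
    · intro w hw
      rw [slice_of_ne, smul_zero]
      rw [h]
      exact fun e => Finset.mem_compl.1 hw (e ▸ Finset.mem_insert_self w τ)
  · rw [slice_of_ne h, map_zero, smul_zero, add_zero]
    by_cases hu : ∃ u ∈ τᶜ, ρ ∩ I = insert u τ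
    · obtain ⟨u, hu, h'⟩ := hu
      rw [Finset.mem_compl] at hu
      have huρ : u ∈ ρ := Finset.mem_of_mem_inter_left (h' ▸ Finset.mem_insert_self u τ)
      have hsub : insert u τ ⊆ ρ := h' ▸ Finset.inter_subset_left
      rw [Finset.sum_eq_single_of_mem u huρ, Finset.sum_eq_single_of_mem u (by simpa using hu),
        slice_of_eq (by rw [hinter, h', Finset.erase_insert hu]), slice_of_eq h',
        Finset.prod_insert hu]
      · have h3 : ρ.erase u \ τ = ρ \ insert u τ := by
          ext x
          simp only [mem_sdiff, mem_erase, mem_insert, not_or]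
          tauto
        have h2 : sg K u ρ = sg K u τ * sg K u (ρ \ insert u τ) := by
          rw [← sg_insert_self u τ, ← sg_union Finset.disjoint_sdiff,
            Finset.union_sdiff_of_subset hsub]
        simp only [h3, h2, Finsupp.smul_single, smul_eq_mul, mul_assoc]
      · intro w hw hne
        rw [slice_of_ne, smul_zero]
        rw [h']
        intro e
        rcases Finset.mem_insert.1 (e ▸ Finset.mem_insert_self u τ : u ∈ insert w τ) with h4 | h4
        · exact hne h4.symm
        · exact hu h4
      · intro v hv hne
        rw [slice_of_ne, smul_zero]
        rw [hinter, h']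
        intro e
        exact hu (e ▸ Finset.mem_erase.2 ⟨hne.symm, Finset.mem_insert_self u τ⟩)
    · rw [Finset.sum_eq_zero, Finset.sum_eq_zero]
      · intro w hw
        rw [slice_of_ne (fun e => hu ⟨w, hw, e⟩), smul_zero]
      · intro v hv
        rw [slice_of_ne, smul_zero]
        rw [hinter]
        intro e
        by_cases hvI : v ∈ I
        · refine hu ⟨v, ?_, ?_⟩
          · simp [← e]
          · rw [← e, Finset.insert_erase (Finset.mem_inter.2 ⟨hv, hvI⟩)]
        · rw [Finset.erase_eq_of_notMem fun hc => hvI (Finset.mem_inter.1 hc).2] at e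
          exact h e

lemma slice_bd [Fintype V] (τ : Finset V) (c : Finset V →₀ K) : slice K I τ (bd K c) =
    (∑ w ∈ τᶜ, sg K w τ • slice K I (insert w τ) c) +
      (-1 : K) ^ τ.card • bd K (slice K I τ c) := by
  have := ext_single (f := slice K I τ ∘ₗ bd K)
    (g := (∑ w ∈ τᶜ, sg K w τ • slice K I (insert w τ)) +
      (-1 : K) ^ τ.card • (bd K ∘ₗ slice K I τ))
    (fun ρ => by simpa [LinearMap.sum_apply] using slice_bd_single (K := K) (I := I) τ ρ) c
  simpa [LinearMap.sum_apply] using this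

lemma sum_powersetCard_compl [Fintype V] {M : Type*} [AddCommMonoid M] (q : ℕ)
    (f : V → Finset V → M) :
    ∑ τ ∈ powersetCard q univ, ∑ w ∈ τᶜ, f w τ =
      ∑ τ ∈ powersetCard (q + 1) univ, ∑ w ∈ τ, f w (τ.erase w) := by
  rw [Finset.sum_sigma', Finset.sum_sigma']
  refine Finset.sum_bij' (fun x _ => ⟨insert x.2 x.1, x.2⟩) (fun x _ => ⟨x.1.erase x.2, x.2⟩)
    ?_ ?_ ?_ ?_ ?_
  · rintro ⟨τ, w⟩ h
    simp only [mem_sigma, mem_powersetCard, subset_univ, true_and, mem_compl] at h ⊢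
    exact ⟨by rw [Finset.card_insert_of_notMem h.2, h.1], Finset.mem_insert_self w τ⟩
  · rintro ⟨τ, w⟩ h
    simp only [mem_sigma, mem_powersetCard, subset_univ, true_and, mem_compl] at h ⊢
    exact ⟨by rw [Finset.card_erase_of_mem h.2, h.1]; omega, Finset.notMem_erase w τ⟩
  · rintro ⟨τ, w⟩ h
    simp only [mem_sigma, mem_compl] at h
    simp [Finset.erase_insert h.2]
  · rintro ⟨τ, w⟩ h
    simp only [mem_sigma] at h
    simp [Finset.insert_erase h.2]
  · rintro ⟨τ, w⟩ h
    simp only [mem_sigma, mem_compl] at h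
    simp [Finset.erase_insert h.2]

/-- The total slice of a family of chains indexed by the sets with `q` elements. -/
noncomputable def totalSlice [Fintype V] (I : Finset V) (q : ℕ)
    (Y : (Finset V →₀ K) →ₗ[K] (Finset V →₀ K)) : Finset V →₀ K :=
  ∑ τ ∈ powersetCard q univ, slice K I τ (Y (Finsupp.single τ 1))

lemma totalSlice_bd [Fintype V] (q : ℕ) (Y : (Finset V →₀ K) →ₗ[K] (Finset V →₀ K)) :
    totalSlice I q (bd K ∘ₗ Y) =
      totalSlice I (q + 1) (Y ∘ₗ bd K) + (-1 : K) ^ q • bd K (totalSlice I q Y) := by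
  have h1 : totalSlice I q (bd K ∘ₗ Y) = ∑ τ ∈ powersetCard q univ,
      ((∑ w ∈ τᶜ, sg K w τ • slice K I (insert w τ) (Y (Finsupp.single τ 1))) +
        (-1 : K) ^ q • bd K (slice K I τ (Y (Finsupp.single τ 1)))) := by
    refine Finset.sum_congr rfl fun τ hτ => ?_
    rw [LinearMap.comp_apply, slice_bd, (Finset.mem_powersetCard.1 hτ).2]
  rw [h1, Finset.sum_add_distrib, ← Finset.smul_sum, ← map_sum,
    sum_powersetCard_compl q fun w τ => sg K w τ • slice K I (insert w τ) (Y (Finsupp.single τ 1))]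
  congr 1
  refine Finset.sum_congr rfl fun τ _ => ?_
  rw [LinearMap.comp_apply, bd_single, map_sum, map_sum]
  refine Finset.sum_congr rfl fun w hw => ?_
  rw [Finset.insert_erase hw, sg_erase_self, ← map_smul, ← map_smul, Finsupp.smul_single,
    smul_eq_mul, mul_one]

lemma slice_eq_zero_of_avoiding {τ : Finset V} {a : Finset V →₀ K} (ha : a ∈ Avoiding K τ) :
    slice K I τ a = 0 := by
  refine map_eq_of_mem_supported (f := slice K I τ) (g := 0) (fun ρ hρ => ?_) ha
  rw [LinearMap.zero_apply]
  exact slice_of_ne fun e => hρ (e ▸ Finset.inter_subset_left)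

lemma map_bd_single_mem_avoiding {f : (Finset V →₀ K) →ₗ[K] (Finset V →₀ K)} {τ : Finset V}
    (h : ∀ w ∈ τ, f (Finsupp.single (τ.erase w) 1) ∈ Avoiding K (τ.erase w)) :
    f (bd K (Finsupp.single τ 1)) ∈ Avoiding K τ := by
  rw [bd_single, map_sum]
  refine Submodule.sum_mem _ fun w hw => ?_
  rw [← mul_one (sg K w τ), ← smul_eq_mul, ← Finsupp.smul_single, map_smul]
  exact Submodule.smul_mem _ _ (avoiding_mono (Finset.erase_subset w τ) (h w hw))

end FaceChain

namespace ASC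

open FaceChain ListChain

variable {V : Type} {K : Type*} [Field K] {Γ : ASC V} {I : Finset V}

variable (K) in
/-- The chains of faces of `Γ` with `k` vertices. -/
noncomputable abbrev ChainsOfCard (Γ : ASC V) (k : ℕ) : Submodule K (Finset V →₀ K) :=
  Finsupp.supported K K (Γ.faces ∩ {σ | σ.card = k})

lemma chainsOfCard_le (Γ : ASC V) (k : ℕ) :
    ChainsOfCard K Γ k ≤ Finsupp.supported K K Γ.faces :=
  Finsupp.supported_mono Set.inter_subset_left

lemma mem_chainsOfCard_deletion {k : ℕ} {τ : Finset V} {c : Finset V →₀ K}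
    (hc : c ∈ ChainsOfCard K Γ k) (h : c ∈ Avoiding K τ) :
    c ∈ ChainsOfCard K (Γ.deletion τ) k :=
  (Finsupp.mem_supported _ _).2 fun _ hρ => ⟨⟨((Finsupp.mem_supported _ _).1 hc hρ).1,
    (Finsupp.mem_supported _ _).1 h hρ⟩, ((Finsupp.mem_supported _ _).1 hc hρ).2⟩

lemma chainsOfCard_deletion_le (τ : Finset V) (k : ℕ) :
    ChainsOfCard K (Γ.deletion τ) k ≤ ChainsOfCard K Γ k ⊓ Avoiding K τ :=
  le_inf (Finsupp.supported_mono fun _ h => ⟨h.1.1, h.2⟩) (Finsupp.supported_mono fun _ h => h.1.2)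

variable [LinearOrder V]

lemma bd_mem_chainsOfCard {k : ℕ} {c : Finset V →₀ K} (hc : c ∈ ChainsOfCard K Γ (k + 1)) :
    bd K c ∈ ChainsOfCard K Γ k := by
  refine map_mem_of_mem_supported (fun ρ hρ => Finsupp.supported_mono ?_ (bd_single_mem ρ)) hc
  intro σ hσ
  have h1 : σ.card + 1 = ρ.card := hσ.2
  have h2 : ρ.card = k + 1 := hρ.2
  exact ⟨Γ.down_closed hρ.1 hσ.1, Nat.succ_injective (h1.trans h2)⟩

lemma bd_eq_zero_of_card_zero {c : Finset V →₀ K} (hc : c ∈ ChainsOfCard K Γ 0) :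
    bd K c = 0 := by
  refine map_eq_of_mem_supported (f := bd K) (g := 0) (fun ρ hρ => ?_) hc
  rw [Finset.card_eq_zero.1 hρ.2, bd_single, Finset.sum_empty, LinearMap.zero_apply]

lemma exists_chainsOfCard_of_bd_eq {k : ℕ} {z w : Finset V →₀ K} (hz : z ∈ ChainsOfCard K Γ k)
    (hw : w ∈ Finsupp.supported K K Γ.faces) (hb : bd K w = z) :
    ∃ w ∈ ChainsOfCard K Γ (k + 1), bd K w = z :=
  exists_homogeneous_primitive Finset.card (bd K)
    (fun ρ => Finsupp.supported_mono (fun _ h => h.2) (bd_single_mem ρ))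
    (Finsupp.supported_mono (fun _ h => h.2) hz) hw hb

lemma AcyclicAt.exists_chainsOfCard {k : ℕ} (h : AcyclicAt K Γ k) {z : Finset V →₀ K}
    (hz : z ∈ ChainsOfCard K Γ k) (hcyc : bd K z = 0) :
    ∃ w ∈ ChainsOfCard K Γ (k + 1), bd K w = z := by
  obtain ⟨w, hw, hb⟩ := h z hz hcyc
  exact exists_chainsOfCard_of_bd_eq hz hw hb

namespace IsSphere

variable {d : ℕ}

lemma exists_avoiding (hΓ : IsSphere K Γ d) {k : ℕ} {τ : Finset V} (hτ : τ ∈ Γ.faces)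
    {x : Finset V →₀ K} (hx : x ∈ ChainsOfCard K Γ k) (hb : bd K x ∈ Avoiding K τ) :
    ∃ y ∈ ChainsOfCard K Γ k ⊓ Avoiding K τ, bd K y = bd K x := by
  rcases τ.eq_empty_or_nonempty with rfl | hne
  · exact ⟨0, Submodule.zero_mem _, by rw [eq_zero_of_avoiding_empty hb, map_zero]⟩
  cases k with
  | zero => exact ⟨0, Submodule.zero_mem _, by rw [bd_eq_zero_of_card_zero hx, map_zero]⟩
  | succ k =>
    obtain ⟨y, hy, h⟩ := (hΓ.acyclicAt_deletion τ hτ hne k).exists_chainsOfCard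
      (mem_chainsOfCard_deletion (bd_mem_chainsOfCard hx) hb) (bd_bd x)
    exact ⟨y, chainsOfCard_deletion_le τ _ hy, h⟩

lemma exists_relative_primitive (hΓ : IsSphere K Γ d) {k : ℕ} (hk : k < d) {τ : Finset V}
    (hτ : τ ∈ Γ.faces) {x : Finset V →₀ K} (hx : x ∈ ChainsOfCard K Γ k)
    (hb : bd K x ∈ Avoiding K τ) :
    ∃ u ∈ ChainsOfCard K Γ (k + 1), x - bd K u ∈ Avoiding K τ := by
  obtain ⟨y, hy, h⟩ := hΓ.exists_avoiding hτ hx hb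
  obtain ⟨u, hu, h'⟩ := (hΓ.acyclicAt k hk).exists_chainsOfCard (Submodule.sub_mem _ hx hy.1)
    (by rw [map_sub, h, sub_self])
  refine ⟨u, hu, ?_⟩
  rw [h', sub_sub_cancel]
  exact hy.2

/-- A generator of the top homology. -/
noncomputable def fundamentalCycle (hΓ : IsSphere K Γ d) : Finset V →₀ K :=
  hΓ.exists_fundamentalCycle.choose

lemma fundamentalCycle_mem (hΓ : IsSphere K Γ d) : hΓ.fundamentalCycle ∈ ChainsOfCard K Γ d :=
  hΓ.exists_fundamentalCycle.choose_spec.1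

lemma bd_fundamentalCycle (hΓ : IsSphere K Γ d) : bd K hΓ.fundamentalCycle = 0 :=
  hΓ.exists_fundamentalCycle.choose_spec.2.1

lemma exists_relative_eq_smul (hΓ : IsSphere K Γ d) {τ : Finset V} (hτ : τ ∈ Γ.faces)
    {x : Finset V →₀ K} (hx : x ∈ ChainsOfCard K Γ d) (hb : bd K x ∈ Avoiding K τ) :
    ∃ a : K, x - a • hΓ.fundamentalCycle ∈ Avoiding K τ := by
  obtain ⟨y, hy, h⟩ := hΓ.exists_avoiding hτ hx hb
  obtain ⟨a, ha⟩ := hΓ.exists_fundamentalCycle.choose_spec.2.2.2 (x - y)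
    (Submodule.sub_mem _ hx hy.1) (by rw [map_sub, h, sub_self])
  refine ⟨a, ?_⟩
  rw [fundamentalCycle, ← ha, sub_sub_cancel]
  exact hy.2

lemma eq_zero_of_card_lt (hΓ : IsSphere K Γ d) {c : Finset V →₀ K}
    (hc : c ∈ ChainsOfCard K Γ (d + 1)) : c = 0 := by
  rw [← Finsupp.support_eq_empty, Finset.eq_empty_iff_forall_notMem]
  intro ρ hρ
  obtain ⟨h1, h2⟩ := (Finsupp.mem_supported _ _).1 hc hρ
  have h3 : ρ.card = d + 1 := h2
  have := hΓ.card_le ρ h1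
  omega

lemma fundamentalCycle_notMem_avoiding (hΓ : IsSphere K Γ d) {τ : Finset V} (hτ : τ ∈ Γ.faces) :
    hΓ.fundamentalCycle ∉ Avoiding K τ := by
  intro h
  refine hΓ.exists_fundamentalCycle.choose_spec.2.2.1 ?_
  change hΓ.fundamentalCycle = 0
  rcases τ.eq_empty_or_nonempty with rfl | hne
  · exact eq_zero_of_avoiding_empty h
  · obtain ⟨w, hw, hb⟩ := (hΓ.acyclicAt_deletion τ hτ hne d).exists_chainsOfCard
      (mem_chainsOfCard_deletion hΓ.fundamentalCycle_mem h) hΓ.bd_fundamentalCycle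
    rw [← hb, hΓ.eq_zero_of_card_lt (chainsOfCard_deletion_le τ _ hw).1, map_zero]

end IsSphere

lemma slice_mem {k q : ℕ} {τ : Finset V} (hτ : τ.card = q) {c : Finset V →₀ K} [Fintype V]
    (hc : c ∈ ChainsOfCard K Γ (q + k)) :
    slice K I τ c ∈ ChainsOfCard K (Γ.restrict Iᶜ) k := by
  refine map_mem_of_mem_supported (fun ρ hρ => ?_) hc
  by_cases h : ρ ∩ I = τ
  · rw [slice_of_eq h]
    refine Finsupp.single_mem_supported K _
      ⟨⟨Γ.down_closed hρ.1 Finset.sdiff_subset, fun v hv => ?_⟩, ?_⟩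
    · rw [Finset.mem_compl]
      intro hvI
      rw [Finset.mem_sdiff, ← h] at hv
      exact hv.2 (Finset.mem_inter.2 ⟨hv.1, hvI⟩)
    · have h1 : ρ.card = q + k := hρ.2
      change (ρ \ τ).card = k
      rw [Finset.card_sdiff_of_subset (h ▸ Finset.inter_subset_left)]
      omega
  · rw [slice_of_ne h]
    exact Submodule.zero_mem _

lemma slice_eq_zero_of_notMem {τ : Finset V} (hτ : τ ∉ (Γ.restrict I).faces)
    {c : Finset V →₀ K} (hc : c ∈ Finsupp.supported K K Γ.faces) : slice K I τ c = 0 := by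
  refine map_eq_of_mem_supported (f := slice K I τ) (g := 0) (fun ρ hρ => ?_) hc
  rw [LinearMap.zero_apply]
  refine slice_of_ne fun e => hτ ?_
  exact e ▸ ⟨Γ.down_closed hρ Finset.inter_subset_left, Finset.inter_subset_right⟩

lemma slice_empty [Fintype V] {c : Finset V →₀ K}
    (hc : c ∈ Finsupp.supported K K (Γ.restrict Iᶜ).faces) : slice K I ∅ c = c := by
  refine map_eq_of_mem_supported (f := slice K I ∅) (g := LinearMap.id) (fun ρ hρ => ?_) hc
  rw [slice_of_eq]
  · simp
  · rw [← Finset.disjoint_iff_inter_eq_empty]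
    exact Finset.disjoint_left.2 fun v hv => Finset.mem_compl.1 (hρ.2 hv)

/-- Slices of families agreeing up to avoiding chains coincide. -/
lemma totalSlice_congr [Fintype V] {q : ℕ} {X Y : (Finset V →₀ K) →ₗ[K] (Finset V →₀ K)}
    (hX : ∀ τ, τ.card = q → X (Finsupp.single τ 1) ∈ Finsupp.supported K K Γ.faces)
    (hY : ∀ τ, τ.card = q → Y (Finsupp.single τ 1) ∈ Finsupp.supported K K Γ.faces)
    (h : ∀ τ ∈ (Γ.restrict I).faces, τ.card = q →
      X (Finsupp.single τ 1) - Y (Finsupp.single τ 1) ∈ Avoiding K τ) :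
    totalSlice I q X = totalSlice I q Y := by
  refine Finset.sum_congr rfl fun τ hτ => ?_
  have hq := (Finset.mem_powersetCard.1 hτ).2
  by_cases hτI : τ ∈ (Γ.restrict I).faces
  · rw [← sub_eq_zero, ← map_sub]
    exact slice_eq_zero_of_avoiding (h τ hτI hq)
  · rw [slice_eq_zero_of_notMem hτI (hX τ hq), slice_eq_zero_of_notMem hτI (hY τ hq)]

lemma totalSlice_mem [Fintype V] {q k : ℕ} {Y : (Finset V →₀ K) →ₗ[K] (Finset V →₀ K)}
    (hY : ∀ τ, τ.card = q → Y (Finsupp.single τ 1) ∈ ChainsOfCard K Γ (q + k)) :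
    totalSlice I q Y ∈ ChainsOfCard K (Γ.restrict Iᶜ) k :=
  Submodule.sum_mem _ fun τ hτ =>
    slice_mem (Finset.mem_powersetCard.1 hτ).2 (hY τ (Finset.mem_powersetCard.1 hτ).2)

end ASC

namespace ASC

open FaceChain ListChain

variable {V : Type} [LinearOrder V] {K : Type*} [Field K] {Γ : ASC V} {I : Finset V}

lemma bd_single_mem_card {q : ℕ} {τ : Finset V} (hτ : τ.card = q + 1) :
    bd K (Finsupp.single τ 1) ∈ Finsupp.supported K K {σ : Finset V | σ.card = q} :=
  Finsupp.supported_mono (fun _ h => Nat.succ_injective (h.2.trans hτ)) (bd_single_mem τ)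

lemma erase_mem_restrict {τ : Finset V} (hτ : τ ∈ (Γ.restrict I).faces) (w : V) :
    τ.erase w ∈ (Γ.restrict I).faces :=
  (Γ.restrict I).down_closed hτ (Finset.erase_subset w τ)

lemma IsSphere.smulRight_mem {d : ℕ} (hΓ : IsSphere K Γ d) (φ : (Finset V →₀ K) →ₗ[K] K)
    (x : Finset V →₀ K) :
    φ.smulRight hΓ.fundamentalCycle x ∈ ChainsOfCard K Γ d :=
  Submodule.smul_mem _ _ hΓ.fundamentalCycle_mem

variable [Fintype V]

/-- The family `X` of chains, indexed by the faces inside `I` with `q` elements, is a relative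
cocycle whose total slice is homologous to `c` in the restriction to the complement of `I`. -/
structure Represents (Γ : ASC V) (I : Finset V) (k : ℕ) (c : Finset V →₀ K) (q : ℕ)
    (X : (Finset V →₀ K) →ₗ[K] (Finset V →₀ K)) : Prop where
  mem : ∀ τ, τ.card = q → X (Finsupp.single τ 1) ∈ ChainsOfCard K Γ (q + k)
  bd_mem : ∀ τ ∈ (Γ.restrict I).faces, τ.card = q →
    bd K (X (Finsupp.single τ 1)) ∈ Avoiding K τ
  map_bd_mem : ∀ τ ∈ (Γ.restrict I).faces, τ.card = q + 1 →
    X (bd K (Finsupp.single τ 1)) ∈ Avoiding K τ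
  sub_mem : c - totalSlice I q X ∈
    (Finsupp.supported K K (Γ.restrict Iᶜ).faces).map (bd K)

lemma represents_zero {k : ℕ} {c : Finset V →₀ K} (hc : c ∈ ChainsOfCard K (Γ.restrict Iᶜ) k)
    (hb : bd K c = 0) : Represents Γ I k c 0 ((Finsupp.lapply ∅).smulRight c) where
  mem τ hτ := by
    rw [Finset.card_eq_zero.1 hτ, zero_add]
    exact Submodule.smul_mem _ _ (Finsupp.supported_mono
      (fun _ h => ⟨h.1.1, h.2⟩ : _ ⊆ Γ.faces ∩ {σ | σ.card = k}) hc)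
  bd_mem τ _ _ := by
    rw [LinearMap.smulRight_apply, map_smul, hb, smul_zero]
    exact Submodule.zero_mem _
  map_bd_mem τ hτ hq := by
    refine Submodule.smul_mem _ _ (Finsupp.supported_mono (fun ρ h hsub => ?_) hc)
    obtain ⟨v, hv⟩ := Finset.card_pos.1 (hq.symm ▸ Nat.succ_pos 0 : 0 < τ.card)
    exact Finset.mem_compl.1 (h.1.2 (hsub hv)) (hτ.2 hv)
  sub_mem := by
    rw [totalSlice, Finset.powersetCard_zero, Finset.sum_singleton, LinearMap.smulRight_apply,
      Finsupp.lapply_apply, Finsupp.single_eq_same, one_smul,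
      slice_empty (chainsOfCard_le _ _ hc), sub_self]
    exact Submodule.zero_mem _

namespace IsSphere

variable {d : ℕ}

lemma exists_represents_succ (hΓ : IsSphere K Γ d) {k q : ℕ} (hq : q + k < d)
    {c : Finset V →₀ K} {X : (Finset V →₀ K) →ₗ[K] (Finset V →₀ K)}
    (hX : Represents Γ I k c q X) : ∃ X', Represents Γ I k c (q + 1) X' := by
  have hY : ∀ τ : Finset V, ∃ y ∈ ChainsOfCard K Γ (q + k + 1),
      τ ∈ (Γ.restrict I).faces → τ.card = q →
        X (Finsupp.single τ 1) - bd K y ∈ Avoiding K τ := by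
    intro τ
    by_cases h : τ ∈ (Γ.restrict I).faces ∧ τ.card = q
    · obtain ⟨u, hu, h'⟩ := hΓ.exists_relative_primitive hq h.1.1 (hX.mem τ h.2)
        (hX.bd_mem τ h.1 h.2)
      exact ⟨u, hu, fun _ _ => h'⟩
    · exact ⟨0, Submodule.zero_mem _, fun h1 h2 => (h ⟨h1, h2⟩).elim⟩
  choose y hy hxy using hY
  set Y : (Finset V →₀ K) →ₗ[K] (Finset V →₀ K) := Finsupp.linearCombination K y with hYdef
  have hYs : ∀ τ, Y (Finsupp.single τ 1) = y τ := fun τ => by simp [hYdef]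
  refine ⟨Y ∘ₗ bd K, ⟨fun τ hτ => ?_, fun τ hτ hc => ?_, fun τ _ _ => ?_, ?_⟩⟩
  · rw [add_right_comm]
    exact map_mem_of_mem_supported (f := Y) (fun ρ _ => (hYs ρ).symm ▸ hy ρ)
      (bd_single_mem_card hτ)
  · have h1 : (X - bd K ∘ₗ Y) (bd K (Finsupp.single τ 1)) ∈ Avoiding K τ := by
      refine map_bd_single_mem_avoiding fun w hw => ?_
      rw [LinearMap.sub_apply, LinearMap.comp_apply, hYs]
      exact hxy _ (erase_mem_restrict hτ w) (by rw [Finset.card_erase_of_mem hw, hc]; rfl)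
    have h2 := Submodule.sub_mem _ (hX.map_bd_mem τ hτ hc) h1
    rwa [LinearMap.sub_apply, sub_sub_cancel] at h2
  · rw [LinearMap.comp_apply, bd_bd, map_zero]
    exact Submodule.zero_mem _
  · have h1 : totalSlice I q X = totalSlice I q (bd K ∘ₗ Y) := by
      refine totalSlice_congr (Γ := Γ) (fun τ hτ => chainsOfCard_le _ _ (hX.mem τ hτ))
        (fun τ _ => ?_) (fun τ hτ hc => ?_)
      · rw [LinearMap.comp_apply, hYs]
        exact chainsOfCard_le _ _ (bd_mem_chainsOfCard (hy τ))
      · rw [LinearMap.comp_apply, hYs]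
        exact hxy τ hτ hc
    have h2 : totalSlice I q Y ∈ ChainsOfCard K (Γ.restrict Iᶜ) (k + 1) :=
      totalSlice_mem fun τ _ => by rw [hYs]; exact hy τ
    have h3 : c - totalSlice I (q + 1) (Y ∘ₗ bd K) =
        (c - totalSlice I q X) + bd K ((-1 : K) ^ q • totalSlice I q Y) := by
      rw [h1, totalSlice_bd, map_smul]
      abel
    rw [h3]
    exact Submodule.add_mem _ hX.sub_mem (Submodule.mem_map_of_mem
      (Submodule.smul_mem _ _ (chainsOfCard_le _ _ h2)))

lemma exists_represents (hΓ : IsSphere K Γ d) {k : ℕ} {c : Finset V →₀ K}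
    (hc : c ∈ ChainsOfCard K (Γ.restrict Iᶜ) k) (hb : bd K c = 0) (q : ℕ) (hq : q + k ≤ d) :
    ∃ X, Represents Γ I k c q X := by
  induction q with
  | zero => exact ⟨_, represents_zero hc hb⟩
  | succ q ih =>
    obtain ⟨X, hX⟩ := ih (by omega)
    exact hΓ.exists_represents_succ (by omega) hX

/-- The chain dual to a cochain: its cap product with the fundamental cycle. -/
noncomputable def dualChain (hΓ : IsSphere K Γ d) (I : Finset V) (p : ℕ) :
    ((Finset V →₀ K) →ₗ[K] K) →ₗ[K] (Finset V →₀ K) where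
  toFun φ := totalSlice I p (φ.smulRight hΓ.fundamentalCycle)
  map_add' φ ψ := by simp [totalSlice, add_smul, Finset.sum_add_distrib]
  map_smul' a φ := by simp [totalSlice, mul_smul, Finset.smul_sum]

lemma dualChain_mem (hΓ : IsSphere K Γ d) {p k : ℕ} (h : p + k = d)
    (φ : (Finset V →₀ K) →ₗ[K] K) :
    hΓ.dualChain I p φ ∈ ChainsOfCard K (Γ.restrict Iᶜ) k := by
  subst h
  exact totalSlice_mem fun _ _ => hΓ.smulRight_mem φ _

lemma dualChain_eq_zero (hΓ : IsSphere K Γ d) {p : ℕ} {φ : (Finset V →₀ K) →ₗ[K] K}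
    (h : ∀ τ ∈ (Γ.restrict I).faces, τ.card = p → φ (Finsupp.single τ 1) = 0) :
    hΓ.dualChain I p φ = 0 := by
  refine Finset.sum_eq_zero fun τ hτ => ?_
  by_cases hI : τ ∈ (Γ.restrict I).faces
  · rw [LinearMap.smulRight_apply, h τ hI (Finset.mem_powersetCard.1 hτ).2, zero_smul, map_zero]
  · exact slice_eq_zero_of_notMem hI (chainsOfCard_le _ _ (hΓ.smulRight_mem φ _))

lemma dualChain_congr (hΓ : IsSphere K Γ d) {p : ℕ} {φ ψ : (Finset V →₀ K) →ₗ[K] K}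
    (h : ∀ τ ∈ (Γ.restrict I).faces, τ.card = p →
      φ (Finsupp.single τ 1) = ψ (Finsupp.single τ 1)) :
    hΓ.dualChain I p φ = hΓ.dualChain I p ψ := by
  rw [← sub_eq_zero, ← map_sub]
  exact hΓ.dualChain_eq_zero fun τ hτ hp => sub_eq_zero.2 (h τ hτ hp)

/-- Up to sign, taking dual chains intertwines the coboundary with the boundary. -/
lemma dualChain_comp_bd (hΓ : IsSphere K Γ d) (p : ℕ) (φ : (Finset V →₀ K) →ₗ[K] K) :
    hΓ.dualChain I (p + 1) (φ ∘ₗ bd K) = -((-1 : K) ^ p • bd K (hΓ.dualChain I p φ)) := by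
  have h1 : bd K ∘ₗ φ.smulRight hΓ.fundamentalCycle = 0 := by
    ext1 τ
    ext1
    simp [hΓ.bd_fundamentalCycle]
  have h2 := totalSlice_bd (I := I) p (φ.smulRight hΓ.fundamentalCycle)
  rw [h1] at h2
  have h3 : totalSlice I p (0 : (Finset V →₀ K) →ₗ[K] (Finset V →₀ K)) = 0 := by
    simp [totalSlice]
  rw [h3] at h2
  exact eq_neg_of_add_eq_zero_left h2.symm

lemma bd_dualChain (hΓ : IsSphere K Γ d) {p : ℕ} {φ : (Finset V →₀ K) →ₗ[K] K}
    (h : ∀ τ ∈ (Γ.restrict I).faces, τ.card = p + 1 → φ (bd K (Finsupp.single τ 1)) = 0) :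
    bd K (hΓ.dualChain I p φ) = 0 := by
  have h1 := hΓ.dualChain_comp_bd (I := I) p φ
  rw [hΓ.dualChain_eq_zero h, eq_comm, neg_eq_zero] at h1
  exact (smul_eq_zero.1 h1).resolve_left (pow_ne_zero _ (neg_ne_zero.2 one_ne_zero))

/-- Every cycle in the restriction to the complement of `I` is homologous to the dual chain of a
cocycle of the restriction to `I`. -/
lemma exists_dualChain (hΓ : IsSphere K Γ d) {p k : ℕ} (h : p + k = d) {c : Finset V →₀ K}
    (hc : c ∈ ChainsOfCard K (Γ.restrict Iᶜ) k) (hb : bd K c = 0) :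
    ∃ φ : (Finset V →₀ K) →ₗ[K] K,
      (∀ τ ∈ (Γ.restrict I).faces, τ.card = p + 1 → φ (bd K (Finsupp.single τ 1)) = 0) ∧
      c - hΓ.dualChain I p φ ∈ (Finsupp.supported K K (Γ.restrict Iᶜ).faces).map (bd K) := by
  obtain ⟨X, hX⟩ := hΓ.exists_represents hc hb p h.le
  have ha : ∀ τ : Finset V, ∃ a : K, τ ∈ (Γ.restrict I).faces → τ.card = p →
      X (Finsupp.single τ 1) - a • hΓ.fundamentalCycle ∈ Avoiding K τ := by
    intro τ
    by_cases hτ : τ ∈ (Γ.restrict I).faces ∧ τ.card = p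
    · obtain ⟨a, ha⟩ := hΓ.exists_relative_eq_smul hτ.1.1 (h ▸ hX.mem τ hτ.2)
        (hX.bd_mem τ hτ.1 hτ.2)
      exact ⟨a, fun _ _ => ha⟩
    · exact ⟨0, fun h1 h2 => (hτ ⟨h1, h2⟩).elim⟩
  choose a ha using ha
  set φ : (Finset V →₀ K) →ₗ[K] K := Finsupp.linearCombination K a with hφ
  have hφs : ∀ τ, φ (Finsupp.single τ 1) = a τ := fun τ => by simp [hφ]
  refine ⟨φ, fun τ hτ hp => ?_, ?_⟩
  · have h1 : (X - φ.smulRight hΓ.fundamentalCycle) (bd K (Finsupp.single τ 1)) ∈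
        Avoiding K τ := by
      refine map_bd_single_mem_avoiding fun w hw => ?_
      rw [LinearMap.sub_apply, LinearMap.smulRight_apply, hφs]
      exact ha _ (erase_mem_restrict hτ w) (by rw [Finset.card_erase_of_mem hw, hp]; rfl)
    have h2 := Submodule.sub_mem _ (hX.map_bd_mem τ hτ hp) h1
    rw [LinearMap.sub_apply, sub_sub_cancel, LinearMap.smulRight_apply] at h2
    by_contra h3
    exact hΓ.fundamentalCycle_notMem_avoiding hτ.1 ((Submodule.smul_mem_iff _ h3).1 h2)
  · have h1 : totalSlice I p X = hΓ.dualChain I p φ := by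
      refine totalSlice_congr (Γ := Γ) (fun τ hτ => chainsOfCard_le _ _ (hX.mem τ hτ))
        (fun τ _ => chainsOfCard_le _ _ (hΓ.smulRight_mem φ _)) (fun τ hτ hp => ?_)
      rw [LinearMap.smulRight_apply, hφs]
      exact ha τ hτ hp
    rw [← h1]
    exact hX.sub_mem

end IsSphere

end ASC

section Subquotient

variable {K : Type*} [Field K]

lemma finrank_subquotient_add {A : Type*} [AddCommGroup A] [Module K A] [FiniteDimensional K A]
    {Z B : Submodule K A} (h : B ≤ Z) :
    Module.finrank K (Z ⧸ B.comap Z.subtype) + Module.finrank K B = Module.finrank K Z := by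
  rw [← (Submodule.comapSubtypeEquivOfLe h).finrank_eq]
  exact Submodule.finrank_quotient_add_finrank _

lemma finrank_subquotient_le {A B : Type*} [AddCommGroup A] [Module K A] [FiniteDimensional K A]
    [AddCommGroup B] [Module K B] {Z₁ B₁ : Submodule K A} {Z₂ B₂ : Submodule K B} (L : A →ₗ[K] B)
    (hZ : ∀ x ∈ Z₁, L x ∈ Z₂) (hB : ∀ x ∈ B₁, L x ∈ B₂)
    (hs : ∀ y ∈ Z₂, ∃ x ∈ Z₁, y - L x ∈ B₂) :
    Module.finrank K (Z₂ ⧸ B₂.comap Z₂.subtype) ≤ Module.finrank K (Z₁ ⧸ B₁.comap Z₁.subtype) := by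
  refine LinearMap.finrank_le_finrank_of_surjective
    (f := Submodule.mapQ _ _ (L.restrict hZ) fun x hx => hB x.1 hx) fun y => ?_
  obtain ⟨y, rfl⟩ := Submodule.mkQ_surjective _ y
  obtain ⟨x, hx, h⟩ := hs y.1 y.2
  refine ⟨Submodule.Quotient.mk ⟨x, hx⟩, ((Submodule.Quotient.eq _).2 ?_).symm⟩
  exact h

lemma finrank_subquotient_eq {A B C A' B' C' : Type*} [AddCommGroup A] [Module K A]
    [AddCommGroup B] [Module K B] [FiniteDimensional K B] [AddCommGroup C] [Module K C]
    [AddCommGroup A'] [Module K A'] [AddCommGroup B'] [Module K B'] [FiniteDimensional K B']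
    [AddCommGroup C'] [Module K C'] {f : A →ₗ[K] B} {g : B →ₗ[K] C} {f' : B' →ₗ[K] A'}
    {g' : C' →ₗ[K] B'} (h : g ∘ₗ f = 0) (h' : f' ∘ₗ g' = 0)
    (hB : Module.finrank K B' = Module.finrank K B)
    (hf : Module.finrank K (LinearMap.range f') = Module.finrank K (LinearMap.range f))
    (hg : Module.finrank K (LinearMap.range g') = Module.finrank K (LinearMap.range g)) :
    Module.finrank K (LinearMap.ker f' ⧸
      (LinearMap.range g').comap (LinearMap.ker f').subtype) =
    Module.finrank K (LinearMap.ker g ⧸ (LinearMap.range f).comap (LinearMap.ker g).subtype) := by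
  have h1 := finrank_subquotient_add (LinearMap.range_le_ker_iff.2 h)
  have h2 := finrank_subquotient_add (LinearMap.range_le_ker_iff.2 h')
  have h3 := g.finrank_range_add_finrank_ker
  have h4 := f'.finrank_range_add_finrank_ker
  omega

end Subquotient

namespace ASC

open FaceChain ListChain

section Translation

variable {V : Type} {K : Type} [Field K] {Γ : ASC V} {j : ℤ}

instance [Finite V] (Γ : ASC V) (j : ℤ) : Finite (Cells Γ j) :=
  inferInstanceAs (Finite {σ : Finset V // σ ∈ Γ.faces ∧ (σ.card : ℤ) = j + 1})

instance [Finite V] (Γ : ASC V) (j : ℤ) : FiniteDimensional K (Chains K Γ j) :=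
  inferInstanceAs (FiniteDimensional K (Cells Γ j →₀ K))

instance [Finite V] (Γ : ASC V) (j : ℤ) : FiniteDimensional K (Cochains K Γ j) :=
  inferInstanceAs (FiniteDimensional K (Module.Dual K (Chains K Γ j)))

/-- The chain supported on a single cell. -/
noncomputable def cellChain (σ : Cells Γ j) (a : K) : Chains K Γ j :=
  (Finsupp.single σ a : Cells Γ j →₀ K)

lemma chains_hom_ext {M : Type*} [AddCommMonoid M] [Module K M] {f g : Chains K Γ j →ₗ[K] M}
    (h : ∀ σ : Cells Γ j, f (cellChain σ 1) = g (cellChain σ 1)) : f = g :=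
  Finsupp.lhom_ext' (M := K) (R := K) fun σ : Cells Γ j => LinearMap.ext_ring (h σ)

/-- A cochain, regarded as a linear functional. -/
def Cochains.toHom (φ : Cochains K Γ j) : Chains K Γ j →ₗ[K] K := φ

/-- The inclusion of the chains of a complex in the chains of all finite sets. -/
noncomputable def chainsIncl (K : Type) [Field K] (Γ : ASC V) (j : ℤ) :
    Chains K Γ j →ₗ[K] (Finset V →₀ K) :=
  Finsupp.lmapDomain K K (Subtype.val : Cells Γ j → Finset V)

/-- The projection of the chains of all finite sets to the chains of a complex. -/
noncomputable def chainsProj (K : Type) [Field K] (Γ : ASC V) (j : ℤ) :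
    (Finset V →₀ K) →ₗ[K] Chains K Γ j :=
  Finsupp.lcomapDomain (Subtype.val : Cells Γ j → Finset V) Subtype.val_injective

lemma chainsIncl_cellChain (σ : Cells Γ j) (a : K) :
    chainsIncl K Γ j (cellChain σ a) = Finsupp.single σ.1 a :=
  Finsupp.mapDomain_single

lemma chainsProj_chainsIncl (x : Chains K Γ j) : chainsProj K Γ j (chainsIncl K Γ j x) = x :=
  Finsupp.comapDomain_mapDomain _ Subtype.val_injective x

lemma chainsIncl_injective : Function.Injective (chainsIncl K Γ j) :=
  Function.LeftInverse.injective chainsProj_chainsIncl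

lemma chainsIncl_mem {n : ℕ} (hn : (n : ℤ) = j + 1) (x : Chains K Γ j) :
    chainsIncl K Γ j x ∈ ChainsOfCard K Γ n := by
  classical
  refine (Finsupp.mem_supported _ _).2 fun σ hσ => ?_
  obtain ⟨τ, -, rfl⟩ := Finset.mem_image.1 (Finsupp.mapDomain_support hσ)
  exact ⟨τ.2.1, Nat.cast_injective (R := ℤ) (τ.2.2.trans hn.symm)⟩

lemma chainsIncl_chainsProj {n : ℕ} (hn : (n : ℤ) = j + 1) {c : Finset V →₀ K}
    (hc : c ∈ ChainsOfCard K Γ n) : chainsIncl K Γ j (chainsProj K Γ j c) = c := by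
  refine Finsupp.mapDomain_comapDomain _ Subtype.val_injective c fun σ hσ => ?_
  obtain ⟨h1, h2⟩ := (Finsupp.mem_supported _ _).1 hc hσ
  exact ⟨(⟨σ, h1, (congrArg Nat.cast h2).trans hn⟩ : Cells Γ j), rfl⟩

lemma isEmpty_cells_of_neg (h : j + 1 < 0) : IsEmpty (Cells Γ j) :=
  ⟨fun σ => by have := σ.2.2; omega⟩

lemma subsingleton_chains [IsEmpty (Cells Γ j)] : Subsingleton (Chains K Γ j) :=
  inferInstanceAs (Subsingleton (Cells Γ j →₀ K))

/-- The extension of a cochain of a complex by zero. -/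
noncomputable def extendCochain (K : Type) [Field K] (Γ : ASC V) (j : ℤ) :
    Cochains K Γ j →ₗ[K] ((Finset V →₀ K) →ₗ[K] K) :=
  LinearMap.lcomp K K (chainsProj K Γ j)

lemma extendCochain_apply (φ : Cochains K Γ j) (c : Finset V →₀ K) :
    extendCochain K Γ j φ c = φ.toHom (chainsProj K Γ j c) := rfl

/-- The restriction of a cochain on all finite sets. -/
noncomputable def restrictCochain (Γ : ASC V) (j : ℤ) (φ : (Finset V →₀ K) →ₗ[K] K) :
    Cochains K Γ j :=
  φ ∘ₗ chainsIncl K Γ j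

lemma restrictCochain_toHom (φ : (Finset V →₀ K) →ₗ[K] K) (x : Chains K Γ j) :
    (restrictCochain Γ j φ).toHom x = φ (chainsIncl K Γ j x) := rfl

lemma extendCochain_restrictCochain (φ : (Finset V →₀ K) →ₗ[K] K) {n : ℕ} (hn : (n : ℤ) = j + 1)
    {c : Finset V →₀ K} (hc : c ∈ ChainsOfCard K Γ n) :
    extendCochain K Γ j (restrictCochain Γ j φ) c = φ c := by
  rw [extendCochain_apply, restrictCochain_toHom, chainsIncl_chainsProj hn hc]

lemma single_mem_chainsOfCard {n : ℕ} {τ : Finset V} (hτ : τ ∈ Γ.faces) (hn : τ.card = n) :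
    Finsupp.single τ (1 : K) ∈ ChainsOfCard K Γ n :=
  Finsupp.single_mem_supported K _ ⟨hτ, hn⟩

variable [LinearOrder V]

lemma boundary_single {k : ℤ} (hk : k = j - 1) (σ : Cells Γ j) :
    boundary K Γ j k hk (cellChain σ 1) =
      ∑ v ∈ σ.1.attach, cellChain (⟨σ.1.erase v.1,
        Γ.down_closed σ.2.1 (Finset.erase_subset _ _), by
          have h1 := Finset.card_erase_of_mem v.2
          have h2 := Finset.card_pos.2 ⟨v.1, v.2⟩
          have h3 := σ.2.2
          omega⟩ : Cells Γ k)
        ((-1 : K) ^ (σ.1.filter (fun w => w < v.1)).card) := by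
  refine (Finsupp.lsum_single K _ σ (1 : K)).trans ?_
  exact one_smul K _

lemma chainsIncl_boundary {k : ℤ} (hk : k = j - 1) (x : Chains K Γ j) :
    chainsIncl K Γ k (boundary K Γ j k hk x) = bd K (chainsIncl K Γ j x) := by
  have h : chainsIncl K Γ k ∘ₗ boundary K Γ j k hk = bd K ∘ₗ chainsIncl K Γ j := by
    refine chains_hom_ext fun σ => ?_
    rw [LinearMap.comp_apply, LinearMap.comp_apply, chainsIncl_cellChain, bd_single,
      boundary_single, map_sum, ← Finset.sum_attach σ.1]
    refine Finset.sum_congr rfl fun v _ => ?_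
    rw [sg_eq]
    exact chainsIncl_cellChain _ _
  exact LinearMap.congr_fun h x

lemma boundary_comp_boundary {k l : ℤ} (hk : k = j - 1) (hl : l = k - 1) :
    boundary K Γ k l hl ∘ₗ boundary K Γ j k hk = 0 := by
  ext1 x
  apply chainsIncl_injective
  rw [LinearMap.comp_apply, chainsIncl_boundary, chainsIncl_boundary, bd_bd, LinearMap.zero_apply,
    map_zero]

lemma coboundary_comp_coboundary {k l : ℤ} (hk : k = j + 1) (hl : l = k + 1) :
    coboundary K Γ k l hl ∘ₗ coboundary K Γ j k hk = 0 := by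
  refine LinearMap.ext fun φ => LinearMap.ext fun x => ?_
  exact (congrArg φ.toHom
    (LinearMap.congr_fun (boundary_comp_boundary (k := k) (by omega) (by omega)) x)).trans
    (map_zero φ.toHom)

lemma finrank_reducedCohomology [Finite V] (Γ : ASC V) (j : ℤ) :
    Module.finrank K (reducedCohomology K Γ j) = Module.finrank K (reducedHomology K Γ j) := by
  refine finrank_subquotient_eq (boundary_comp_boundary _ _)
    (coboundary_comp_coboundary _ _) ?_ ?_ ?_
  · exact Subspace.dual_finrank_eq (K := K) (V := Chains K Γ j)
  · exact (boundary K Γ (j + 1) j (by omega)).finrank_range_dualMap_eq_finrank_range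
  · exact (boundary K Γ j (j - 1) rfl).finrank_range_dualMap_eq_finrank_range

lemma coboundary_restrictCochain {k : ℤ} (hk : k = j + 1) {φ : (Finset V →₀ K) →ₗ[K] K} {n : ℕ}
    (hn : (n : ℤ) = k + 1)
    (h : ∀ τ ∈ Γ.faces, τ.card = n → φ (bd K (Finsupp.single τ 1)) = 0) :
    coboundary K Γ j k hk (restrictCochain Γ j φ) = 0 := by
  refine chains_hom_ext fun σ => ?_
  refine ((restrictCochain_toHom φ _).trans ?_).trans (LinearMap.zero_apply (cellChain σ 1)).symm
  rw [chainsIncl_boundary, chainsIncl_cellChain]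
  exact h σ.1 σ.2.1 (Nat.cast_injective (R := ℤ) (σ.2.2.trans hn.symm))

lemma chainsProj_bd {k : ℤ} (hk : k = j - 1) {n : ℕ} (hn : (n : ℤ) = j + 1) {c : Finset V →₀ K}
    (hc : c ∈ ChainsOfCard K Γ n) :
    chainsProj K Γ k (bd K c) = boundary K Γ j k hk (chainsProj K Γ j c) := by
  rw [← chainsProj_chainsIncl (boundary K Γ j k hk (chainsProj K Γ j c)), chainsIncl_boundary,
    chainsIncl_chainsProj hn hc]

lemma extendCochain_bd {k : ℤ} (hk : k = j + 1) (φ : Cochains K Γ j) {n : ℕ}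
    (hn : (n : ℤ) = k + 1) {c : Finset V →₀ K} (hc : c ∈ ChainsOfCard K Γ n) :
    extendCochain K Γ j φ (bd K c) = extendCochain K Γ k (coboundary K Γ j k hk φ) c :=
  congrArg φ.toHom (chainsProj_bd (k := j) (by omega) hn hc)

lemma IsSphere.finrank_reducedHomology_le [Fintype V] {d : ℕ} (hΓ : IsSphere K Γ d)
    (I : Finset V) {p k : ℕ} (h : p + k = d) {a b : ℤ} (ha : (p : ℤ) = a + 1)
    (hb : (k : ℤ) = b + 1) :
    Module.finrank K (reducedHomology K (Γ.restrict Iᶜ) b) ≤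
      Module.finrank K (reducedCohomology K (Γ.restrict I) a) := by
  refine finrank_subquotient_le
    (chainsProj K (Γ.restrict Iᶜ) b ∘ₗ hΓ.dualChain I p ∘ₗ extendCochain K (Γ.restrict I) a)
    ?_ ?_ ?_
  · intro φ hφ
    rw [LinearMap.mem_ker] at hφ ⊢
    apply chainsIncl_injective
    rw [chainsIncl_boundary, LinearMap.comp_apply, LinearMap.comp_apply,
      chainsIncl_chainsProj hb (hΓ.dualChain_mem h _), map_zero]
    refine hΓ.bd_dualChain fun τ hτ hc => ?_
    rw [extendCochain_bd rfl φ (by omega) (single_mem_chainsOfCard hτ hc), hφ, map_zero,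
      LinearMap.zero_apply]
  · rintro _ ⟨ψ, rfl⟩
    rw [LinearMap.comp_apply, LinearMap.comp_apply]
    cases p with
    | zero =>
      rw [hΓ.dualChain_eq_zero, map_zero]
      · exact Submodule.zero_mem _
      · intro τ hτ hc
        rw [← extendCochain_bd _ ψ ha (single_mem_chainsOfCard hτ hc),
          bd_eq_zero_of_card_zero (single_mem_chainsOfCard hτ hc), map_zero]
    | succ p =>
      have h1 : hΓ.dualChain I (p + 1) (extendCochain K (Γ.restrict I) a
          (coboundary K (Γ.restrict I) (a - 1) a (by omega) ψ)) =
          hΓ.dualChain I (p + 1) (extendCochain K (Γ.restrict I) (a - 1) ψ ∘ₗ bd K) :=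
        hΓ.dualChain_congr fun τ hτ hc =>
          (extendCochain_bd _ ψ ha (single_mem_chainsOfCard hτ hc)).symm
      have h2 : hΓ.dualChain I p (extendCochain K (Γ.restrict I) (a - 1) ψ) ∈
          ChainsOfCard K (Γ.restrict Iᶜ) (k + 1) := hΓ.dualChain_mem (by omega) _
      rw [h1, hΓ.dualChain_comp_bd, map_neg, map_smul,
        chainsProj_bd (j := b + 1) (by omega) (by omega) h2]
      exact Submodule.neg_mem _ (Submodule.smul_mem _ _ (LinearMap.mem_range_self _ _))
  · intro y hy
    rw [LinearMap.mem_ker] at hy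
    obtain ⟨φ, hφ, hs⟩ := hΓ.exists_dualChain h (chainsIncl_mem hb y)
      (by rw [← chainsIncl_boundary rfl, hy, map_zero])
    refine ⟨restrictCochain (Γ.restrict I) a φ, ?_, ?_⟩
    · rw [LinearMap.mem_ker]
      exact coboundary_restrictCochain rfl (by push_cast; omega) hφ
    · obtain ⟨w, hw, hwb⟩ := hs
      obtain ⟨u, hu, hub⟩ := exists_chainsOfCard_of_bd_eq
        (Submodule.sub_mem _ (chainsIncl_mem hb y) (hΓ.dualChain_mem h φ)) hw hwb
      refine ⟨chainsProj K _ _ u, ?_⟩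
      rw [← chainsProj_bd (n := k + 1) _ (by push_cast; omega) hu, hub, map_sub,
        chainsProj_chainsIncl, LinearMap.comp_apply, LinearMap.comp_apply]
      congr 2
      exact hΓ.dualChain_congr fun τ hτ hc =>
        (extendCochain_restrictCochain φ ha (single_mem_chainsOfCard hτ hc)).symm

lemma card_le_of_homeomorph (K : Type) [Field K] [Fintype V] {d : ℕ}
    (e : Γ.realization ≃ₜ Metric.sphere (0 : EuclideanSpace ℝ (Fin d)) 1) {σ : Finset V}
    (hσ : σ ∈ Γ.faces) : σ.card ≤ d := by
  rcases d.eq_zero_or_pos with rfl | hd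
  · by_contra! h
    have h1 := (e ⟨_, barycenter_mem (Finset.card_pos.1 h) hσ⟩).2
    rw [mem_sphere_zero_iff_norm, Subsingleton.elim (Subtype.val _) 0, norm_zero] at h1
    exact zero_ne_one h1
  · exact (isSphere_of_homeomorph K hd e).card_le σ hσ

lemma finrank_reducedHomology_compl [Fintype V] {d : ℕ}
    (e : Γ.realization ≃ₜ Metric.sphere (0 : EuclideanSpace ℝ (Fin d)) 1) (I : Finset V)
    {i : ℤ} (hi : 1 ≤ i) :
    Module.finrank K (reducedHomology K (Γ.restrict Iᶜ) ((d : ℤ) - 1 - i)) =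
      Module.finrank K (reducedHomology K (Γ.restrict I) (i - 1)) := by
  by_cases hid : i ≤ d
  · lift i to ℕ using by omega
    have hΓ := isSphere_of_homeomorph K (by omega) e
    refine le_antisymm ?_ ?_
    · rw [← finrank_reducedCohomology (Γ.restrict I)]
      exact hΓ.finrank_reducedHomology_le I (p := i) (k := d - i) (by omega) (by omega) (by omega)
    · rw [← finrank_reducedCohomology (Γ.restrict Iᶜ)]
      have h := hΓ.finrank_reducedHomology_le Iᶜ (p := d - i) (k := i) (a := (d : ℤ) - 1 - i)
        (b := (i : ℤ) - 1) (by omega) (by omega) (by omega)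
      rwa [compl_compl] at h
  · have : IsEmpty (Cells (Γ.restrict Iᶜ) ((d : ℤ) - 1 - i)) := isEmpty_cells_of_neg (by omega)
    have : IsEmpty (Cells (Γ.restrict I) (i - 1)) := ⟨fun σ => by
      have h1 := card_le_of_homeomorph K e σ.2.1.1
      have h2 := σ.2.2
      omega⟩
    have := subsingleton_chains (K := K) (Γ := Γ.restrict Iᶜ) (j := (d : ℤ) - 1 - i)
    have := subsingleton_chains (K := K) (Γ := Γ.restrict I) (j := i - 1)
    rw [Module.finrank_zero_of_subsingleton, Module.finrank_zero_of_subsingleton]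

end Translation

end ASC

/-- Theorem 1.1(b) ("Serre duality for Betti numbers"): let `P` be a simplicial complex with
`‖P‖ ≅ S^{d-1}`.  For every `I ⊆ V` and every integer `i ≥ 1`,
`H̃_{d-1-i}(P_{≤Î}; K) ≅ H̃^{i-1}(P_{≤I}; K)`; in particular
`dim_K H̃_{d-1-i}(P_{≤Î}; K) = dim_K H̃_{i-1}(P_{≤I}; K)`. -/
theorem serre_duality_for_betti_numbers {V : Type} [Fintype V] [LinearOrder V]
    (K : Type) [Field K] (d : ℕ) (P : ASC V)
    (hP : Nonempty (↥(ASC.realization P) ≃ₜ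
      ↥(Metric.sphere (0 : EuclideanSpace ℝ (Fin d)) 1)))
    (I : Finset V) (i : ℤ) (hi : 1 ≤ i) :
    Nonempty (ASC.reducedHomology K (P.restrict Iᶜ) ((d : ℤ) - 1 - i) ≃ₗ[K]
        ASC.reducedCohomology K (P.restrict I) (i - 1)) ∧
      Module.rank K (ASC.reducedHomology K (P.restrict Iᶜ) ((d : ℤ) - 1 - i)) =
        Module.rank K (ASC.reducedHomology K (P.restrict I) (i - 1)) := by
  obtain ⟨e⟩ := hP
  have h := ASC.finrank_reducedHomology_compl (K := K) e I hi
  refine ⟨FiniteDimensional.nonempty_linearEquiv_of_finrank_eq ?_, ?_⟩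
  · rw [ASC.finrank_reducedCohomology, h]
  · rw [← Module.finrank_eq_rank, ← Module.finrank_eq_rank, h]
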